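/- Let n > 2k ≥ 2, θ ∈ (0,1), let ω ⊂ ℝⁿ be a C^{2k,θ}-smooth bounded domain with 0 ∈ ω, and let ε > 0. Let G_{(εω)^c}(x,y) := ε^{n−2k}|x|^{2k−n}|y|^{2k−n} G_{ω₀}(ε·inv(x), ε·inv(y)) for x,y ∈ ℝⁿ∖εω, where inv(x) = x/|x|², ω₀ := inv(ℝⁿ∖ω̄) ∪ {0}, and G_{ω₀} is the Dirichlet Green function of (−Δ)^k on ω₀. Then for every function φ : ℝⁿ∖εω → ℝ of class C^{2k} with compact support whose normal derivatives ∂_ν^{(i)}φ vanish on ∂(εω) for i = 0, …, k−1, one has φ(x) = ∫_{ℝⁿ∖εω} G_{(εω)^c}(x,y) (−Δ)^k φ(y) dy for all x ∈ ℝⁿ∖εω̄. -/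

import Mathlib

open Metric Set MeasureTheory Bornology Filter Pointwise

noncomputable section

/-- Euclidean space `ℝⁿ`. -/
abbrev Euc (n : ℕ) : Type := EuclideanSpace ℝ (Fin n)

/-- A `C^{m,θ}`-smooth bounded domain of `ℝⁿ`, described via a defining function `ρ`
of class `C^m` whose `m`-th derivative is `θ`-Hölder continuous, with nonvanishing
gradient on the boundary. -/
def IsHolderDomain (n m : ℕ) (θ : ℝ) (Ω : Set (Euc n)) : Prop :=
  IsOpen Ω ∧ IsBounded Ω ∧ IsConnected Ω ∧
  ∃ ρ : Euc n → ℝ, ContDiff ℝ m ρ ∧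
    (∃ C : ℝ, ∀ x y : Euc n,
      ‖iteratedFDeriv ℝ m ρ x - iteratedFDeriv ℝ m ρ y‖ ≤ C * ‖x - y‖ ^ θ) ∧
    Ω = {x | ρ x < 0} ∧ frontier Ω = {x | ρ x = 0} ∧
    ∀ x ∈ frontier Ω, fderiv ℝ ρ x ≠ 0

/-- The Euclidean Laplacian `Δ f`. -/
def eucLap {n : ℕ} (f : Euc n → ℝ) (x : Euc n) : ℝ :=
  ∑ i : Fin n, iteratedFDeriv ℝ 2 f x ![EuclideanSpace.single i 1, EuclideanSpace.single i 1]

/-- The polyharmonic operator `(−Δ)^k`. -/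
def polyLap {n : ℕ} (k : ℕ) (f : Euc n → ℝ) : Euc n → ℝ :=
  (fun g x => - eucLap g x)^[k] f

/-- `θ`-Hölder continuity on a set. -/
def HolderOn {n : ℕ} (θ : ℝ) (f : Euc n → ℝ) (s : Set (Euc n)) : Prop :=
  ∃ C : ℝ, ∀ x ∈ s, ∀ y ∈ s, |f x - f y| ≤ C * ‖x - y‖ ^ θ

/-- `u ∈ C^{2k,θ}(D̄)` solves the Dirichlet problem `(−Δ)^k u = f` in `D`,
`u = ∂_ν u = … = ∂_ν^{(k−1)} u = 0` on `∂D` (the boundary conditions being encoded as the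
vanishing of all derivatives of order `< k` on the boundary). -/
def IsDirichletSolution {n : ℕ} (k : ℕ) (θ : ℝ) (D : Set (Euc n)) (f u : Euc n → ℝ) : Prop :=
  ContDiffOn ℝ (2*k) u (closure D) ∧
  (∃ C : ℝ, ∀ x ∈ closure D, ∀ y ∈ closure D,
      ‖iteratedFDerivWithin ℝ (2*k) u (closure D) x -
        iteratedFDerivWithin ℝ (2*k) u (closure D) y‖ ≤ C * ‖x - y‖ ^ θ) ∧
  (∀ x ∈ D, polyLap k u x = f x) ∧
  (∀ i : ℕ, i < k → ∀ x ∈ frontier D, iteratedFDerivWithin ℝ i u (closure D) x = 0)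

/-- `G` is the Dirichlet Green function of `(−Δ)^k` on `D`: for every `f ∈ C^{0,θ}(D̄)`,
`x ↦ ∫_D G(x,y) f(y) dy` is the unique solution of the Dirichlet problem. -/
def IsGreenFunction {n : ℕ} (k : ℕ) (θ : ℝ) (D : Set (Euc n)) (G : Euc n → Euc n → ℝ) : Prop :=
  ∀ f : Euc n → ℝ, ContinuousOn f (closure D) → HolderOn θ f (closure D) →
    IsDirichletSolution k θ D f (fun x => ∫ y in D, G x y * f y) ∧
    ∀ u : Euc n → ℝ, IsDirichletSolution k θ D f u →
      ∀ x ∈ closure D, u x = ∫ y in D, G x y * f y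

/-- The inversion at the unit sphere, `inv(x) = x/|x|²`. -/
def invMap {n : ℕ} (x : Euc n) : Euc n := (‖x‖ ^ 2)⁻¹ • x

/-- `ω₀ := inv(ℝⁿ ∖ ω̄) ∪ {0}`. -/
def omegaZero {n : ℕ} (ω : Set (Euc n)) : Set (Euc n) :=
  (invMap '' (closure ω)ᶜ) ∪ {0}

/-- The exterior Green function
`G_{(εω)^c}(x,y) := ε^{n−2k} |x|^{2k−n} |y|^{2k−n} G₀(ε·inv(x), ε·inv(y))`,
where `G₀` is the Dirichlet Green function of `(−Δ)^k` on `ω₀`. -/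
def extGreen {n : ℕ} (k : ℕ) (G₀ : Euc n → Euc n → ℝ) (ε : ℝ) (x y : Euc n) : ℝ :=
  ε ^ ((n : ℝ) - 2*k) * ‖x‖ ^ (2*(k:ℝ) - n) * ‖y‖ ^ (2*(k:ℝ) - n) *
    G₀ (ε • invMap x) (ε • invMap y)

section Operators

variable {n : ℕ}

/-- The directional derivative of `f` in the direction `v`. -/
def pd (v : Euc n) (f : Euc n → ℝ) (x : Euc n) : ℝ := fderiv ℝ f x v

/-- The `i`-th standard basis vector. -/
abbrev stdVec (i : Fin n) : Euc n := EuclideanSpace.single i 1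

lemma ContDiffOn.pd {U : Set (Euc n)} (hU : IsOpen U) {f : Euc n → ℝ} {m : ℕ}
    (hf : ContDiffOn ℝ (m + 1 : ℕ) f U) (v : Euc n) : ContDiffOn ℝ m (pd v f) U :=
  (hf.fderiv_of_isOpen hU (by norm_cast)).clm_apply contDiffOn_const

lemma ContDiffOn.differentiableAt_of_isOpen {U : Set (Euc n)} (hU : IsOpen U)
    {F : Type*} [NormedAddCommGroup F] [NormedSpace ℝ F] {f : Euc n → F} {m : ℕ}
    (hf : ContDiffOn ℝ m f U) (hm : 1 ≤ m) {x : Euc n} (hx : x ∈ U) : DifferentiableAt ℝ f x :=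
  (hf.contDiffAt (hU.mem_nhds hx)).differentiableAt (by norm_cast; omega)

lemma pd_congr {U : Set (Euc n)} (hU : IsOpen U) {f g : Euc n → ℝ} (h : EqOn f g U) (v : Euc n) :
    EqOn (pd v f) (pd v g) U := fun x hx => by
  have : f =ᶠ[nhds x] g := h.eventuallyEq_of_mem (hU.mem_nhds hx)
  simp only [pd, this.fderiv_eq]

lemma pd_pd_eq {U : Set (Euc n)} (hU : IsOpen U) {f : Euc n → ℝ} (hf : ContDiffOn ℝ 2 f U)
    {x : Euc n} (hx : x ∈ U) (v w : Euc n) :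
    pd v (pd w f) x = fderiv ℝ (fderiv ℝ f) x v w := by
  have h1 : ContDiffOn ℝ (1 : ℕ) (fderiv ℝ f) U := hf.fderiv_of_isOpen hU (by norm_num)
  have h2 := h1.differentiableAt_of_isOpen hU le_rfl hx
  unfold pd
  rw [fderiv_clm_apply h2 (differentiableAt_const w)]
  simp

lemma pd_comm {U : Set (Euc n)} (hU : IsOpen U) {f : Euc n → ℝ} (hf : ContDiffOn ℝ 2 f U)
    {x : Euc n} (hx : x ∈ U) (v w : Euc n) : pd v (pd w f) x = pd w (pd v f) x := by
  rw [pd_pd_eq hU hf hx, pd_pd_eq hU hf hx]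
  exact (hf.contDiffAt (hU.mem_nhds hx)).isSymmSndFDerivAt (by simp) v w

lemma eucLap_eq {U : Set (Euc n)} (hU : IsOpen U) {f : Euc n → ℝ} (hf : ContDiffOn ℝ 2 f U)
    {x : Euc n} (hx : x ∈ U) : eucLap f x = ∑ i : Fin n, pd (stdVec i) (pd (stdVec i) f) x := by
  unfold eucLap
  refine Finset.sum_congr rfl fun i _ => ?_
  rw [iteratedFDeriv_two_apply, pd_pd_eq hU hf hx]
  rfl

lemma eucLap_congr {U : Set (Euc n)} (hU : IsOpen U) {f g : Euc n → ℝ} (h : EqOn f g U) :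
    EqOn (eucLap f) (eucLap g) U := fun x hx => by
  have : f =ᶠ[nhds x] g := h.eventuallyEq_of_mem (hU.mem_nhds hx)
  simp only [eucLap, (this.iteratedFDeriv ℝ 2).eq_of_nhds]

lemma ContDiffOn.eucLap {U : Set (Euc n)} (hU : IsOpen U) {f : Euc n → ℝ} {m : ℕ}
    (hf : ContDiffOn ℝ (m + 2 : ℕ) f U) : ContDiffOn ℝ m (eucLap f) U := by
  refine (ContDiffOn.sum (s := Finset.univ)
    (f := fun i => _root_.pd (stdVec i) (_root_.pd (stdVec i) f))
    fun i _ => ContDiffOn.pd hU (ContDiffOn.pd hU hf _) _).congr fun x hx => ?_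
  rw [eucLap_eq hU (hf.of_le (by norm_cast; omega)) hx]

lemma eucLap_neg (f : Euc n → ℝ) : eucLap (fun x => -f x) = fun x => -eucLap f x := by
  funext x
  have : (fun x => -f x) = -f := rfl
  simp [eucLap, this, iteratedFDeriv_neg_apply]

lemma eucLap_add {U : Set (Euc n)} (hU : IsOpen U) {f g : Euc n → ℝ} (hf : ContDiffOn ℝ 2 f U)
    (hg : ContDiffOn ℝ 2 g U) :
    EqOn (eucLap (fun x => f x + g x)) (fun x => eucLap f x + eucLap g x) U := fun x hx => by
  have h1 := hf.contDiffAt (hU.mem_nhds hx)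
  have h2 := hg.contDiffAt (hU.mem_nhds hx)
  have : (fun x => f x + g x) = f + g := rfl
  simp only [eucLap, this, iteratedFDeriv_add_apply (i := 2) h1 h2, ← Finset.sum_add_distrib]
  rfl

lemma eucLap_const_mul {U : Set (Euc n)} (hU : IsOpen U) {f : Euc n → ℝ}
    (hf : ContDiffOn ℝ 2 f U) (c : ℝ) :
    EqOn (eucLap (fun x => c * f x)) (fun x => c * eucLap f x) U := fun x hx => by
  have h1 := hf.contDiffAt (hU.mem_nhds hx)
  have : (fun x => c * f x) = c • f := rfl
  simp only [eucLap, this, iteratedFDeriv_const_smul_apply (i := 2) h1, Finset.mul_sum]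
  rfl

lemma polyLap_zero (f : Euc n → ℝ) : polyLap 0 f = f := rfl

lemma polyLap_succ (k : ℕ) (f : Euc n → ℝ) :
    polyLap (k + 1) f = polyLap k (fun x => -eucLap f x) := rfl

lemma polyLap_succ' (k : ℕ) (f : Euc n → ℝ) :
    polyLap (k + 1) f = fun x => -eucLap (polyLap k f) x := by
  unfold polyLap
  rw [Function.iterate_succ_apply']

lemma polyLap_congr {U : Set (Euc n)} (hU : IsOpen U) {f g : Euc n → ℝ} (h : EqOn f g U) (k : ℕ) :
    EqOn (polyLap k f) (polyLap k g) U := by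
  induction k generalizing f g with
  | zero => exact h
  | succ k ih =>
    exact ih fun x hx => by simp only [eucLap_congr hU h hx]

lemma ContDiffOn.polyLap {U : Set (Euc n)} (hU : IsOpen U) {f : Euc n → ℝ} {m k : ℕ}
    (hf : ContDiffOn ℝ (m + 2 * k : ℕ) f U) : ContDiffOn ℝ m (polyLap k f) U := by
  induction k generalizing f with
  | zero => exact hf
  | succ k ih => exact ih (ContDiffOn.eucLap hU (m := m + 2 * k) hf).neg

lemma polyLap_add {U : Set (Euc n)} (hU : IsOpen U) {f g : Euc n → ℝ} {k : ℕ}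
    (hf : ContDiffOn ℝ (2 * k : ℕ) f U) (hg : ContDiffOn ℝ (2 * k : ℕ) g U) :
    EqOn (polyLap k (fun x => f x + g x)) (fun x => polyLap k f x + polyLap k g x) U := by
  induction k generalizing f g with
  | zero => exact fun _ _ => rfl
  | succ k ih =>
    intro x hx
    have hf2 : ContDiffOn ℝ 2 f U := hf.of_le (by norm_cast; omega)
    have hg2 : ContDiffOn ℝ 2 g U := hg.of_le (by norm_cast; omega)
    simp only [polyLap_succ]
    rw [polyLap_congr hU (g := fun x => -eucLap f x + -eucLap g x)
      (fun y hy => by simp only [eucLap_add hU hf2 hg2 hy]; ring) k hx]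
    exact ih (ContDiffOn.eucLap hU (m := 2 * k) hf).neg (ContDiffOn.eucLap hU (m := 2 * k) hg).neg hx

lemma polyLap_const_mul {U : Set (Euc n)} (hU : IsOpen U) {f : Euc n → ℝ} {k : ℕ}
    (hf : ContDiffOn ℝ (2 * k : ℕ) f U) (c : ℝ) :
    EqOn (polyLap k (fun x => c * f x)) (fun x => c * polyLap k f x) U := by
  induction k generalizing f with
  | zero => exact fun _ _ => rfl
  | succ k ih =>
    intro x hx
    have hf2 : ContDiffOn ℝ 2 f U := hf.of_le (by norm_cast; omega)
    simp only [polyLap_succ]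
    rw [polyLap_congr hU (g := fun x => c * (-eucLap f x))
      (fun y hy => by simp only [eucLap_const_mul hU hf2 c hy]; ring) k hx]
    exact ih (ContDiffOn.eucLap hU (m := 2 * k) hf).neg hx

end Operators

section KelvinOperators

variable {n : ℕ}

/-- The inversion at the sphere of radius `√ε`. -/
def kap (ε : ℝ) (x : Euc n) : Euc n := ε • invMap x

/-- The Euler derivative `y · ∇f(y)`. -/
def eulerD (f : Euc n → ℝ) (y : Euc n) : ℝ := fderiv ℝ f y y

/-- The Kelvin-type transform `‖x‖ ^ a * φ (ε x / ‖x‖²)`. -/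
def kelvin (ε a : ℝ) (φ : Euc n → ℝ) (x : Euc n) : ℝ := ‖x‖ ^ a * φ (kap ε x)

lemma pd_add {f g : Euc n → ℝ} {x v : Euc n} (hf : DifferentiableAt ℝ f x)
    (hg : DifferentiableAt ℝ g x) : pd v (fun z => f z + g z) x = pd v f x + pd v g x := by
  simp only [pd, fderiv_fun_add hf hg]; rfl

lemma pd_const_mul {f : Euc n → ℝ} {x v : Euc n} (hf : DifferentiableAt ℝ f x) (c : ℝ) :
    pd v (fun z => c * f z) x = c * pd v f x := by
  simp only [pd, fderiv_const_mul hf]; rfl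

lemma hasFDerivAt_norm_rpow_of_ne {x : Euc n} (hx : x ≠ 0) (a : ℝ) :
    HasFDerivAt (fun x : Euc n => ‖x‖ ^ a) ((a * ‖x‖ ^ (a - 2)) • innerSL ℝ x) x := by
  have h0 : 0 < ‖x‖ := norm_pos_iff.2 hx
  have h1 := (hasStrictFDerivAt_norm_sq x).hasFDerivAt.rpow_const (p := a / 2)
    (Or.inl (by positivity))
  have hp : ∀ b : ℝ, ∀ y : Euc n, (‖y‖ ^ 2) ^ b = ‖y‖ ^ (2 * b) := fun b y => by
    rw [← Real.rpow_natCast_mul (norm_nonneg y)]; norm_num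
  simp only [hp] at h1
  rw [show 2 * (a / 2 - 1) = a - 2 by ring, show 2 * (a / 2) = a by ring] at h1
  refine h1.congr_fderiv ?_
  rw [← Nat.cast_smul_eq_nsmul ℝ, smul_smul]
  congr 1
  push_cast
  ring

lemma hasFDerivAt_kap {x : Euc n} (hx : x ≠ 0) (ε : ℝ) :
    HasFDerivAt (kap ε)
      ((ε * ‖x‖ ^ (-2 : ℝ)) • ContinuousLinearMap.id ℝ (Euc n) +
        ((-2 * ε * ‖x‖ ^ (-4 : ℝ)) • innerSL ℝ x).smulRight x) x := by
  have h := ((hasFDerivAt_norm_rpow_of_ne hx (-2)).smul (hasFDerivAt_id x)).const_smul ε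
  have e : (kap ε : Euc n → Euc n) = ε • ((fun x : Euc n => ‖x‖ ^ (-2 : ℝ)) • id) := by
    funext y
    simp only [kap, invMap, Pi.smul_apply, Pi.smul_apply', id]
    rw [Real.rpow_neg (norm_nonneg y)]; norm_cast
  rw [e]
  refine h.congr_fderiv ?_
  ext v
  simp
  norm_num
  ring

lemma kap_eq (ε : ℝ) (x : Euc n) : kap ε x = (ε * ‖x‖ ^ (-2 : ℝ)) • x := by
  simp only [kap, invMap, smul_smul]
  rw [Real.rpow_neg (norm_nonneg x)]; norm_cast

lemma rpow_mul_norm {x : Euc n} (hx : x ≠ 0) (a b : ℝ) :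
    ‖x‖ ^ a * ‖x‖ ^ b = ‖x‖ ^ (a + b) := (Real.rpow_add (norm_pos_iff.2 hx) a b).symm

lemma pd_kelvin {x : Euc n} (hx : x ≠ 0) (ε a : ℝ) {φ : Euc n → ℝ}
    (hφ : DifferentiableAt ℝ φ (kap ε x)) (v : Euc n) :
    pd v (kelvin ε a φ) x =
      inner ℝ x v * kelvin ε (a - 2) (fun y => a * φ y - 2 * eulerD φ y) x +
        ε * kelvin ε (a - 2) (pd v φ) x := by
  have h := (hasFDerivAt_norm_rpow_of_ne hx a).mul (hφ.hasFDerivAt.comp x (hasFDerivAt_kap hx ε))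
  have e : kelvin ε a φ = (fun x : Euc n => ‖x‖ ^ a) * (φ ∘ kap ε) := rfl
  have hk : (fderiv ℝ φ (kap ε x)) (kap ε x)
      = ε * ‖x‖ ^ (-2 : ℝ) * (fderiv ℝ φ (kap ε x)) x := by
    conv_lhs => rw [kap_eq ε x, map_smul, ← kap_eq ε x]
    rfl
  unfold pd
  rw [e, h.fderiv]
  simp only [kelvin, eulerD, hk]
  have r1 : ‖x‖ ^ (-2 : ℝ) = (‖x‖ ^ 2)⁻¹ := by rw [Real.rpow_neg (norm_nonneg x)]; norm_cast
  have r2 : ‖x‖ ^ (-4 : ℝ) = (‖x‖ ^ 4)⁻¹ := by rw [Real.rpow_neg (norm_nonneg x)]; norm_cast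
  have r3 : ‖x‖ ^ a = ‖x‖ ^ (a - 2) * ‖x‖ ^ 2 := by
    rw [← Real.rpow_natCast, rpow_mul_norm hx]; congr 1; push_cast; ring
  have h0 : ‖x‖ ≠ 0 := norm_ne_zero_iff.2 hx
  simp only [r1, r2]
  simp
  rw [r3]
  field_simp
  ring

lemma eulerD_eq (f : Euc n → ℝ) (y : Euc n) :
    eulerD f y = ∑ i : Fin n, y i * pd (stdVec i) f y := by
  have : y = ∑ i : Fin n, y i • (stdVec i : Euc n) := by
    ext j; simp [stdVec, Pi.single_apply]
  unfold eulerD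
  conv_lhs => rw [this, map_sum, ← this]
  simp [pd]

lemma ContDiffOn.eulerD {U : Set (Euc n)} (hU : IsOpen U) {f : Euc n → ℝ} {m : ℕ}
    (hf : ContDiffOn ℝ (m + 1 : ℕ) f U) : ContDiffOn ℝ m (eulerD f) U :=
  (hf.fderiv_of_isOpen hU (by norm_cast)).clm_apply contDiffOn_id

lemma hasFDerivAt_coord (i : Fin n) (y : Euc n) :
    HasFDerivAt (fun y : Euc n => y i) (EuclideanSpace.proj i : Euc n →L[ℝ] ℝ) y :=
  (EuclideanSpace.proj i : Euc n →L[ℝ] ℝ).hasFDerivAt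

/-- Differentiating the Euler derivative. -/
lemma pd_eulerD {U : Set (Euc n)} (hU : IsOpen U) {f : Euc n → ℝ} (hf : ContDiffOn ℝ 2 f U)
    {y : Euc n} (hy : y ∈ U) (v : Euc n) :
    pd v (eulerD f) y = eulerD (pd v f) y + pd v f y := by
  have h1 : ContDiffOn ℝ (1 : ℕ) (fderiv ℝ f) U := hf.fderiv_of_isOpen hU (by norm_num)
  have h2 := h1.differentiableAt_of_isOpen hU le_rfl hy
  have h3 : eulerD (pd v f) y = pd y (pd v f) y := rfl
  rw [h3, pd_comm hU hf hy, pd_pd_eq hU hf hy]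
  unfold pd eulerD
  rw [fderiv_clm_apply (u := fun y => y) h2 differentiableAt_id]
  simp [add_comm]

lemma eucLap_eulerD {U : Set (Euc n)} (hU : IsOpen U) {f : Euc n → ℝ} (hf : ContDiffOn ℝ 3 f U)
    {y : Euc n} (hy : y ∈ U) :
    eucLap (eulerD f) y = eulerD (eucLap f) y + 2 * eucLap f y := by
  have hf' : ContDiffOn ℝ (2 + 1 : ℕ) f U := hf
  have hf2 : ContDiffOn ℝ 2 f U := hf.of_le (by norm_num)
  have hp : ∀ v, ContDiffOn ℝ 2 (pd v f) U := fun v => hf'.pd hU v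
  have hpp : ∀ v w, ContDiffOn ℝ 1 (pd w (pd v f)) U := fun v w =>
    ContDiffOn.pd (m := 1) hU (hp v) w
  have hE : ContDiffOn ℝ 2 (eulerD f) U := ContDiffOn.eulerD hU hf'
  rw [eucLap_eq hU hE hy, eucLap_eq hU hf2 hy]
  have key : ∀ i : Fin n, pd (stdVec i) (pd (stdVec i) (eulerD f)) y =
      eulerD (pd (stdVec i) (pd (stdVec i) f)) y + 2 * pd (stdVec i) (pd (stdVec i) f) y := by
    intro i
    rw [pd_congr hU (g := fun z => eulerD (pd (stdVec i) f) z + pd (stdVec i) f z)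
      (fun z hz => pd_eulerD hU hf2 hz _) _ hy]
    have d1 : DifferentiableAt ℝ (eulerD (pd (stdVec i) f)) y :=
      ContDiffOn.differentiableAt_of_isOpen (m := 1) hU
        (ContDiffOn.eulerD hU (hp (stdVec i))) le_rfl hy
    have d2 : DifferentiableAt ℝ (pd (stdVec i) f) y :=
      ContDiffOn.differentiableAt_of_isOpen (m := 2) hU (hp (stdVec i)) (by norm_num) hy
    have : pd (stdVec i) (fun z => eulerD (pd (stdVec i) f) z + pd (stdVec i) f z) y =
        pd (stdVec i) (eulerD (pd (stdVec i) f)) y + pd (stdVec i) (pd (stdVec i) f) y := by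
      rw [pd_add d1 d2]
    rw [this, pd_eulerD hU (hp _) hy]
    ring
  rw [Finset.sum_congr rfl fun i _ => key i, Finset.sum_add_distrib, ← Finset.mul_sum]
  congr 1
  have hL : eulerD (eucLap f) y =
      eulerD (fun z => ∑ i : Fin n, pd (stdVec i) (pd (stdVec i) f) z) y :=
    pd_congr hU (fun z hz => eucLap_eq hU hf2 hz) y hy
  rw [hL]
  unfold eulerD
  rw [fderiv_fun_sum fun i _ => ContDiffOn.differentiableAt_of_isOpen (m := 1) hU
        (hpp (stdVec i) (stdVec i)) le_rfl hy]
  simp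

lemma pd_normSq_mul {f : Euc n → ℝ} {y : Euc n} (hf : DifferentiableAt ℝ f y) (v : Euc n) :
    pd v (fun z => ‖z‖ ^ 2 * f z) y = ‖y‖ ^ 2 * pd v f y + 2 * inner ℝ y v * f y := by
  have h := (hasStrictFDerivAt_norm_sq y).hasFDerivAt.mul hf.hasFDerivAt
  have e : (fun z : Euc n => ‖z‖ ^ 2 * f z) = (fun z : Euc n => ‖z‖ ^ 2) * f := rfl
  unfold pd
  rw [e, h.fderiv]
  simp
  ring

lemma pd_coord_mul {f : Euc n → ℝ} {y : Euc n} (hf : DifferentiableAt ℝ f y) (i : Fin n) :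
    pd (stdVec i) (fun z => inner ℝ z (stdVec i) * f z) y =
      y i * pd (stdVec i) f y + f y := by
  have h := (hasFDerivAt_coord i y).mul hf.hasFDerivAt
  have e : (fun z : Euc n => inner ℝ z (stdVec i) * f z) = (fun z : Euc n => z i) * f := by
    funext z; simp [EuclideanSpace.inner_single_right]
  unfold pd
  rw [e, h.fderiv]
  simp

lemma contDiff_normSq {m : ℕ} : ContDiff ℝ m (fun z : Euc n => ‖z‖ ^ 2) := contDiff_norm_sq ℝ

lemma sum_coord_sq (y : Euc n) : ∑ i : Fin n, y i * y i = ‖y‖ ^ 2 := by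
  rw [EuclideanSpace.norm_sq_eq]
  exact Finset.sum_congr rfl fun i _ => by rw [Real.norm_eq_abs, sq_abs]; ring

lemma eucLap_normSq_mul {U : Set (Euc n)} (hU : IsOpen U) {f : Euc n → ℝ}
    (hf : ContDiffOn ℝ 2 f U) {y : Euc n} (hy : y ∈ U) :
    eucLap (fun z => ‖z‖ ^ 2 * f z) y =
      ‖y‖ ^ 2 * eucLap f y + 4 * eulerD f y + 2 * n * f y := by
  have hF : ContDiffOn ℝ 2 (fun z => ‖z‖ ^ 2 * f z) U :=
    (contDiff_normSq (m := 2)).contDiffOn.mul hf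
  have hp : ∀ v, ContDiffOn ℝ 1 (pd v f) U := fun v => ContDiffOn.pd (m := 1) hU hf v
  have df : DifferentiableAt ℝ f y :=
    ContDiffOn.differentiableAt_of_isOpen (m := 2) hU hf (by norm_num) hy
  rw [eucLap_eq hU hF hy, eucLap_eq hU hf hy, eulerD_eq]
  have key : ∀ i : Fin n, pd (stdVec i) (pd (stdVec i) (fun z => ‖z‖ ^ 2 * f z)) y =
      ‖y‖ ^ 2 * pd (stdVec i) (pd (stdVec i) f) y + 4 * (y i * pd (stdVec i) f y) + 2 * f y := by
    intro i
    have dp : DifferentiableAt ℝ (pd (stdVec i) f) y :=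
      ContDiffOn.differentiableAt_of_isOpen (m := 1) hU (hp _) le_rfl hy
    rw [pd_congr hU (g := fun z => ‖z‖ ^ 2 * pd (stdVec i) f z +
      2 * (inner ℝ z (stdVec i) * f z))
      (fun z hz => by
        rw [pd_normSq_mul (ContDiffOn.differentiableAt_of_isOpen (m := 2) hU hf (by norm_num) hz)]
        ring) _ hy]
    have d1 : DifferentiableAt ℝ (fun z => ‖z‖ ^ 2 * pd (stdVec i) f z) y :=
      (contDiff_normSq (m := 1)).contDiffAt.differentiableAt (by norm_num) |>.mul dp
    have d2 : DifferentiableAt ℝ (fun z : Euc n => inner ℝ z (stdVec i) * f z) y :=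
      (differentiableAt_id.inner ℝ (differentiableAt_const _)).mul df
    have : pd (stdVec i) (fun z => ‖z‖ ^ 2 * pd (stdVec i) f z +
        2 * (inner ℝ z (stdVec i) * f z)) y =
        pd (stdVec i) (fun z => ‖z‖ ^ 2 * pd (stdVec i) f z) y +
        2 * pd (stdVec i) (fun z => (inner ℝ z (stdVec i) * f z)) y := by
      rw [pd_add d1 (d2.const_mul 2), pd_const_mul d2]
    rw [this, pd_normSq_mul dp, pd_coord_mul df]
    simp [EuclideanSpace.inner_single_right]
    ring
  rw [Finset.sum_congr rfl fun i _ => key i, Finset.sum_add_distrib, Finset.sum_add_distrib,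
    ← Finset.mul_sum, ← Finset.mul_sum]
  simp
  ring

end KelvinOperators

section KelvinFormula

variable {n : ℕ}

lemma contDiffAt_kap {x : Euc n} (hx : x ≠ 0) (ε : ℝ) {m : ℕ} : ContDiffAt ℝ m (kap ε) x := by
  unfold kap invMap
  have h : ContDiffAt ℝ m (fun y : Euc n => (‖y‖ ^ 2)⁻¹) x :=
    contDiff_normSq.contDiffAt.inv (by positivity)
  exact (h.smul contDiffAt_id).const_smul ε

lemma contDiffAt_norm_rpow_of_ne {x : Euc n} (hx : x ≠ 0) (a : ℝ) {m : ℕ} :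
    ContDiffAt ℝ m (fun x : Euc n => ‖x‖ ^ a) x :=
  (contDiffAt_norm ℝ hx).rpow_const_of_ne (norm_ne_zero_iff.2 hx)

lemma isOpen_kap_preimage (ε : ℝ) {V : Set (Euc n)} (hV : IsOpen V) :
    IsOpen {x : Euc n | x ≠ 0 ∧ kap ε x ∈ V} := by
  have h : ContinuousOn (kap ε : Euc n → Euc n) {x | x ≠ 0} := fun x hx =>
    (contDiffAt_kap (m := 0) hx ε).continuousAt.continuousWithinAt
  exact h.isOpen_inter_preimage isOpen_ne hV

lemma ContDiffOn.kelvin {V : Set (Euc n)} (hV : IsOpen V) {φ : Euc n → ℝ} {m : ℕ}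
    (hφ : ContDiffOn ℝ m φ V) (ε a : ℝ) :
    ContDiffOn ℝ m (kelvin ε a φ) {x : Euc n | x ≠ 0 ∧ kap ε x ∈ V} := fun x hx =>
  ((contDiffAt_norm_rpow_of_ne hx.1 a).mul
    (ContDiffAt.comp x (hφ.contDiffAt (hV.mem_nhds hx.2))
      (contDiffAt_kap hx.1 ε))).contDiffWithinAt

/-- The second order operator `|y|²Δ + b y·∇ + c`. -/
def opP (b c : ℝ) (φ : Euc n → ℝ) (y : Euc n) : ℝ :=
  ‖y‖ ^ 2 * eucLap φ y + b * eulerD φ y + c * φ y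

lemma ContDiffOn.opP {V : Set (Euc n)} (hV : IsOpen V) {φ : Euc n → ℝ} {m : ℕ}
    (hφ : ContDiffOn ℝ (m + 2 : ℕ) φ V) (b c : ℝ) : ContDiffOn ℝ m (opP b c φ) V :=
  ((contDiff_normSq.contDiffOn.mul (hφ.eucLap hV)).add
    (contDiffOn_const.mul (ContDiffOn.eulerD hV (hφ.of_le (by norm_cast; omega))))).add
    (contDiffOn_const.mul (hφ.of_le (by norm_cast; omega)))

lemma eucLap_kelvin {V : Set (Euc n)} (hV : IsOpen V) {φ : Euc n → ℝ}
    (hφ : ContDiffOn ℝ 2 φ V) (ε a : ℝ) {x : Euc n} (hx : x ≠ 0) (hxV : kap ε x ∈ V) :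
    eucLap (kelvin ε a φ) x =
      kelvin ε (a - 2) (opP (4 - 2 * n - 2 * a) (a * (a + n - 2)) φ) x := by
  set U := {x : Euc n | x ≠ 0 ∧ kap ε x ∈ V} with hU'
  have hU : IsOpen U := isOpen_kap_preimage ε hV
  have hxU : x ∈ U := ⟨hx, hxV⟩
  set ψ : Euc n → ℝ := fun y => a * φ y - 2 * eulerD φ y with hψ
  have hφ1 : ∀ y ∈ V, DifferentiableAt ℝ φ y := fun y hy =>
    hφ.differentiableAt_of_isOpen (m := 2) hV (by norm_num) hy
  have hE : ContDiffOn ℝ (1 : ℕ) (eulerD φ) V := ContDiffOn.eulerD hV hφ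
  have hψc : ContDiffOn ℝ (1 : ℕ) ψ V :=
    (contDiffOn_const.mul (hφ.of_le (by norm_num))).sub (contDiffOn_const.mul hE)
  have hpd : ∀ v, ContDiffOn ℝ (1 : ℕ) (pd v φ) V := fun v => ContDiffOn.pd (m := 1) hV hφ v
  rw [eucLap_eq hU (ContDiffOn.kelvin (m := 2) hV hφ ε a) hxU]
  set y := kap ε x with hy
  set N := ‖x‖ ^ (a - 4) with hN
  have h0 : ‖x‖ ≠ 0 := norm_ne_zero_iff.2 hx
  have hN2 : ‖x‖ ^ (a - 2) = N * ‖x‖ ^ 2 := by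
    rw [hN, ← Real.rpow_natCast, rpow_mul_norm hx]; congr 1; push_cast; ring
  have hyi : ∀ i, ε * x i = ‖x‖ ^ 2 * y i := fun i => by
    simp only [hy, kap, invMap, PiLp.smul_apply, smul_eq_mul]
    field_simp
  have hyn : ε ^ 2 = ‖x‖ ^ 2 * ‖y‖ ^ 2 := by
    simp only [hy, kap, invMap, norm_smul, Real.norm_eq_abs, mul_pow, sq_abs]
    field_simp
  have key : ∀ i : Fin n, pd (stdVec i) (pd (stdVec i) (kelvin ε a φ)) x =
      (x i * x i) * (N * ((a - 2) * ψ y - 2 * eulerD ψ y))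
        + (N * ‖x‖ ^ 2) * (y i * pd (stdVec i) ψ y)
        + N * ‖x‖ ^ 2 * ψ y
        + (N * ‖x‖ ^ 2) * ((a - 2) * (y i * pd (stdVec i) φ y)
          - 2 * (y i * pd (stdVec i) (eulerD φ) y) + 2 * (y i * pd (stdVec i) φ y))
        + (N * ‖x‖ ^ 2 * ‖y‖ ^ 2) * pd (stdVec i) (pd (stdVec i) φ) y := by
    intro i
    rw [pd_congr hU (g := fun z => inner ℝ z (stdVec i) * kelvin ε (a - 2) ψ z +
        ε * kelvin ε (a - 2) (pd (stdVec i) φ) z)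
        (fun z hz => pd_kelvin hz.1 ε a (hφ1 _ hz.2) _) _ hxU]
    have dk : ∀ g : Euc n → ℝ, ContDiffOn ℝ (1 : ℕ) g V →
        DifferentiableAt ℝ (kelvin ε (a - 2) g) x := fun g hg =>
      ContDiffOn.differentiableAt_of_isOpen hU (ContDiffOn.kelvin hV hg ε (a - 2)) le_rfl hxU
    have dg : ∀ g : Euc n → ℝ, ContDiffOn ℝ (1 : ℕ) g V → DifferentiableAt ℝ g y := fun g hg =>
      ContDiffOn.differentiableAt_of_isOpen hV hg le_rfl hxV
    have d2 : DifferentiableAt ℝ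
        (fun z : Euc n => inner ℝ z (stdVec i) * kelvin ε (a - 2) ψ z) x :=
      (differentiableAt_id.inner ℝ (differentiableAt_const _)).mul (dk ψ hψc)
    rw [pd_add d2 ((dk _ (hpd _)).const_mul ε), pd_const_mul (dk _ (hpd _)),
      pd_coord_mul (dk ψ hψc), pd_kelvin hx ε (a - 2) (dg ψ hψc),
      pd_kelvin hx ε (a - 2) (dg _ (hpd _))]
    have hsym := pd_eulerD hV hφ hxV (stdVec i)
    simp only [kelvin, ← hy, hN2, show a - 2 - 2 = a - 4 by ring, ← hN,
      EuclideanSpace.inner_single_right]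
    have e2 : eulerD (pd (stdVec i) φ) y = pd (stdVec i) (eulerD φ) y - pd (stdVec i) φ y := by
      linarith
    rw [e2]
    have hi := hyi i
    simp only [conj_trivial, one_mul]
    linear_combination (N * pd (stdVec i) ψ y + N * ((a - 2) * pd (stdVec i) φ y
      - 2 * (pd (stdVec i) (eulerD φ) y - pd (stdVec i) φ y))) * hi
      + N * pd (stdVec i) (pd (stdVec i) φ) y * hyn
  rw [Finset.sum_congr rfl fun i _ => key i]
  simp only [Finset.sum_add_distrib, Finset.sum_sub_distrib, ← Finset.mul_sum, ← Finset.sum_mul,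
    sum_coord_sq, ← eulerD_eq, ← eucLap_eq hV hφ hxV]
  have hEψ : eulerD ψ y = a * eulerD φ y - 2 * eulerD (eulerD φ) y := by
    have d1 := hφ1 y hxV
    have d2 : DifferentiableAt ℝ (eulerD φ) y := hE.differentiableAt_of_isOpen hV le_rfl hxV
    change pd y ψ y = a * pd y φ y - 2 * pd y (eulerD φ) y
    have : ψ = fun z => a * φ z + (-2) * eulerD φ z := by funext z; simp only [hψ]; ring
    rw [this, pd_add (d1.const_mul a) (d2.const_mul (-2)), pd_const_mul d1, pd_const_mul d2]
    ring
  simp only [kelvin, opP, ← hy, hN2, hEψ]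
  simp only [hψ, Finset.sum_const, Finset.card_univ, Fintype.card_fin, nsmul_eq_mul]
  ring

lemma eucLap_opP {V : Set (Euc n)} (hV : IsOpen V) {φ : Euc n → ℝ}
    (hφ : ContDiffOn ℝ 4 φ V) (b c : ℝ) :
    EqOn (eucLap (opP b c φ)) (opP (b + 4) (c + 2 * n + 2 * b) (eucLap φ)) V := by
  intro y hy
  have hL : ContDiffOn ℝ 2 (eucLap φ) V := ContDiffOn.eucLap (m := 2) hV hφ
  have hE : ContDiffOn ℝ 2 (eulerD φ) V :=
    ContDiffOn.eulerD (m := 2) hV (hφ.of_le (by norm_num))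
  have hφ2 : ContDiffOn ℝ 2 φ V := hφ.of_le (by norm_num)
  have h1 : ContDiffOn ℝ 2 (fun z => ‖z‖ ^ 2 * eucLap φ z) V :=
    (contDiff_normSq (m := 2)).contDiffOn.mul hL
  have h2 : ContDiffOn ℝ 2 (fun z => b * eulerD φ z) V := contDiffOn_const.mul hE
  have h3 : ContDiffOn ℝ 2 (fun z => c * φ z) V := contDiffOn_const.mul hφ2
  have e : opP b c φ = fun z => (‖z‖ ^ 2 * eucLap φ z + b * eulerD φ z) + c * φ z := rfl
  rw [e, eucLap_add hV (h1.add h2) h3 hy]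
  simp only
  rw [eucLap_add hV h1 h2 hy]
  simp only
  rw [eucLap_const_mul hV hE b hy, eucLap_const_mul hV hφ2 c hy,
    eucLap_normSq_mul hV hL hy]
  simp only
  rw [eucLap_eulerD hV (hφ.of_le (by norm_num)) hy]
  simp only [opP]
  ring

lemma opP_neg (b c : ℝ) (φ : Euc n → ℝ) :
    opP b c (fun x => -φ x) = fun y => -opP b c φ y := by
  funext y
  have : eulerD (fun x => -φ x) y = -eulerD φ y := by
    simp only [eulerD, fderiv_fun_neg]; rfl
  simp only [opP, eucLap_neg, this]
  ring

lemma polyLap_opP {V : Set (Euc n)} (hV : IsOpen V) {φ : Euc n → ℝ} {j : ℕ}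
    (hφ : ContDiffOn ℝ (2 * j + 2 : ℕ) φ V) (b c : ℝ) :
    EqOn (polyLap j (opP b c φ))
      (opP (b + 4 * j) (c + 2 * n * j + 2 * b * j + 4 * (j * (j - 1))) (polyLap j φ)) V := by
  induction j generalizing φ b c with
  | zero => intro y hy; simp [polyLap_zero]
  | succ j ih =>
    intro y hy
    have h4 : ContDiffOn ℝ 4 φ V := hφ.of_le (by norm_cast; omega)
    rw [polyLap_succ, polyLap_succ, polyLap_congr hV
      (g := opP (b + 4) (c + 2 * n + 2 * b) (fun x => -eucLap φ x)) (fun z hz => by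
        rw [opP_neg]; simp only [eucLap_opP hV h4 b c hz]) j hy,
      ih (ContDiffOn.eucLap (m := 2 * j + 2) hV hφ).neg _ _ hy]
    congr 1
    · push_cast; ring
    · push_cast; ring

/-- Kelvin transform formula for the polyharmonic operator. -/
lemma polyLap_kelvin {V : Set (Euc n)} (hV : IsOpen V) (ε : ℝ) {φ : Euc n → ℝ} {k : ℕ}
    (hφ : ContDiffOn ℝ (2 * k : ℕ) φ V) {x : Euc n} (hx : x ≠ 0) (hxV : kap ε x ∈ V) :
    polyLap k (kelvin ε (2 * k - n) φ) x =
      ε ^ (2 * k) * kelvin ε (-2 * k - n) (polyLap k φ) x := by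
  induction k generalizing φ x with
  | zero => simp [polyLap_zero]
  | succ k ih =>
    have hU := isOpen_kap_preimage ε hV
    have h2 : ContDiffOn ℝ 2 φ V := hφ.of_le (by norm_cast; omega)
    set P := opP (-4 * k) (2 * k * (2 * k + 2 - n)) φ with hP
    have hPc : ContDiffOn ℝ (2 * k : ℕ) P V := ContDiffOn.opP hV hφ _ _
    rw [polyLap_succ, polyLap_congr hU (g := fun z => (-1) * kelvin ε (2 * k - n) P z)
      (fun z hz => by
        simp only []
        rw [eucLap_kelvin hV h2 ε _ hz.1 hz.2, hP, neg_one_mul]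
        congr 2
        · push_cast; ring
        · congr 1 <;> push_cast <;> ring) k ⟨hx, hxV⟩,
      polyLap_const_mul hU (ContDiffOn.kelvin hV hPc ε _) (-1) ⟨hx, hxV⟩]
    simp only
    rw [ih hPc hx hxV]
    have hh : polyLap k P (kap ε x) = -‖kap ε x‖ ^ 2 * polyLap (k + 1) φ (kap ε x) := by
      rw [hP, polyLap_opP hV hφ _ _ hxV, polyLap_succ']
      simp only [opP]
      ring
    simp only [kelvin, hh]
    have h0 : ‖x‖ ≠ 0 := norm_ne_zero_iff.2 hx
    have hN2 : ‖x‖ ^ (-2 * (k : ℝ) - n) = ‖x‖ ^ (-2 * ((k + 1 : ℕ) : ℝ) - n) * ‖x‖ ^ 2 := by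
      rw [← Real.rpow_natCast, rpow_mul_norm hx]; congr 1; push_cast; ring
    have hyn : ε ^ 2 = ‖x‖ ^ 2 * ‖kap ε x‖ ^ 2 := by
      simp only [kap, invMap, norm_smul, Real.norm_eq_abs, mul_pow, sq_abs]
      field_simp
    rw [hN2, show ε ^ (2 * (k + 1)) = ε ^ (2 * k) * ε ^ 2 by ring, hyn]
    ring

end KelvinFormula

section Green

variable {n : ℕ}

/-- Functions of class `C^m` on `D` whose derivatives up to order `m` are bounded and whose
derivatives of order `< j` tend to zero at the boundary. -/
structure BdryClass (D : Set (Euc n)) (m j : ℕ) (f : Euc n → ℝ) : Prop where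
  contDiffOn : ContDiffOn ℝ m f D
  bdd : ∀ i ≤ m, ∃ C, ∀ x ∈ D, ‖iteratedFDeriv ℝ i f x‖ ≤ C
  tendsto : ∀ i < j, i ≤ m → ∀ z ∈ frontier D,
    Tendsto (fun x => ‖iteratedFDeriv ℝ i f x‖) (nhdsWithin z D) (nhds 0)

namespace BdryClass

variable {D : Set (Euc n)} {m j : ℕ} {f g : Euc n → ℝ}

lemma of_le (hf : BdryClass D m j f) {m' j' : ℕ} (hm : m' ≤ m) (hj : j' ≤ j) :
    BdryClass D m' j' f where
  contDiffOn := hf.contDiffOn.of_le (by norm_cast)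
  bdd := fun i hi => hf.bdd i (hi.trans hm)
  tendsto := fun i hi him => hf.tendsto i (hi.trans_le hj) (him.trans hm)

lemma of_norm_le (hf : BdryClass D m j f) {m' j' c : ℕ} (K : ℝ)
    (hg : ContDiffOn ℝ m' g D) (hm : m' + c ≤ m) (hj : j' + c ≤ j ∨ j' = 0)
    (h : ∀ i ≤ m', ∀ x ∈ D, ‖iteratedFDeriv ℝ i g x‖ ≤ K * ‖iteratedFDeriv ℝ (i + c) f x‖) :
    BdryClass D m' j' g where
  contDiffOn := hg
  bdd := fun i hi => by
    obtain ⟨C, hC⟩ := hf.bdd (i + c) (by omega)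
    refine ⟨|K| * C, fun x hx => (h i hi x hx).trans ?_⟩
    exact mul_le_mul (le_abs_self K) (hC x hx) (norm_nonneg _) (abs_nonneg _)
  tendsto := fun i hi him z hz => by
    have h1 := (hf.tendsto (i + c) (by omega) (by omega) z hz).const_mul K
    rw [mul_zero] at h1
    exact squeeze_zero' (Eventually.of_forall fun x => norm_nonneg _)
      (eventually_nhdsWithin_of_forall fun x hx => h i him x hx) h1

lemma pd (hD : IsOpen D) (hf : BdryClass D (m + 1) j f) (v : Euc n) :
    BdryClass D m (j - 1) (pd v f) := by
  refine hf.of_norm_le (c := 1) ‖v‖ (hf.contDiffOn.pd hD v) le_rfl (by omega) ?_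
  intro i hi x hx
  rw [← norm_iteratedFDeriv_fderiv]
  have h1 : ContDiffOn ℝ m (fderiv ℝ f) D :=
    hf.contDiffOn.fderiv_of_isOpen hD (by norm_cast)
  exact norm_iteratedFDeriv_clm_apply_const (h1.contDiffAt (hD.mem_nhds hx)) (by norm_cast)

lemma congr (hD : IsOpen D) (hf : BdryClass D m j f) (h : EqOn g f D) : BdryClass D m j g := by
  refine hf.of_norm_le (c := 0) 1 (hf.contDiffOn.congr h) le_rfl (by omega) ?_
  intro i hi x hx
  have : g =ᶠ[nhds x] f := h.eventuallyEq_of_mem (hD.mem_nhds hx)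
  simp [(this.iteratedFDeriv ℝ i).eq_of_nhds]

lemma const_mul (hD : IsOpen D) (hf : BdryClass D m j f) (c : ℝ) :
    BdryClass D m j (fun x => c * f x) := by
  refine hf.of_norm_le (c := 0) |c| (contDiffOn_const.mul hf.contDiffOn) le_rfl (by omega) ?_
  intro i hi x hx
  have : (fun x => c * f x) = c • f := rfl
  rw [this, iteratedFDeriv_const_smul_apply
    ((hf.contDiffOn.of_le (by norm_cast)).contDiffAt (hD.mem_nhds hx))]
  simp [norm_smul]

lemma add (hD : IsOpen D) (hf : BdryClass D m j f) (hg : BdryClass D m j g) :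
    BdryClass D m j (fun x => f x + g x) := by
  have key : ∀ i ≤ m, ∀ x ∈ D, ‖iteratedFDeriv ℝ i (fun x => f x + g x) x‖ ≤
      ‖iteratedFDeriv ℝ i f x‖ + ‖iteratedFDeriv ℝ i g x‖ := fun i hi x hx => by
    have : (fun x => f x + g x) = f + g := rfl
    rw [this, iteratedFDeriv_add_apply
      ((hf.contDiffOn.of_le (by norm_cast)).contDiffAt (hD.mem_nhds hx))
      ((hg.contDiffOn.of_le (by norm_cast)).contDiffAt (hD.mem_nhds hx))]
    exact norm_add_le _ _
  refine ⟨hf.contDiffOn.add hg.contDiffOn, fun i hi => ?_, fun i hi him z hz => ?_⟩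
  · obtain ⟨C, hC⟩ := hf.bdd i hi
    obtain ⟨C', hC'⟩ := hg.bdd i hi
    exact ⟨C + C', fun x hx => (key i hi x hx).trans (add_le_add (hC x hx) (hC' x hx))⟩
  · have h1 := (hf.tendsto i hi him z hz).add (hg.tendsto i hi him z hz)
    rw [add_zero] at h1
    exact squeeze_zero' (Eventually.of_forall fun x => norm_nonneg _)
      (eventually_nhdsWithin_of_forall fun x hx => key i him x hx) h1

lemma zero : BdryClass D m j (fun _ => 0) := by
  have h : ∀ i, iteratedFDeriv ℝ i (fun _ : Euc n => (0 : ℝ)) = 0 := fun i =>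
    iteratedFDeriv_fun_zero
  refine ⟨contDiffOn_const, fun i _ => ⟨0, fun x _ => by simp [h]⟩, fun i _ _ z _ => ?_⟩
  simpa [h] using tendsto_const_nhds

lemma sum (hD : IsOpen D) {ι : Type*} (s : Finset ι) {F : ι → Euc n → ℝ}
    (h : ∀ i ∈ s, BdryClass D m j (F i)) : BdryClass D m j (fun x => ∑ i ∈ s, F i x) := by
  classical
  induction s using Finset.induction_on with
  | empty => simpa using zero
  | insert a s ha ih =>
    simp only [Finset.sum_insert ha]
    exact (h a (by simp)).add hD (ih fun i hi => h i (by simp [hi]))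

lemma eucLap (hD : IsOpen D) (hf : BdryClass D (m + 2) j f) :
    BdryClass D m (j - 2) (eucLap f) := by
  refine (sum hD Finset.univ (F := fun i => _root_.pd (stdVec i) (_root_.pd (stdVec i) f))
    fun i _ => (pd (m := m) hD (pd (m := m + 1) hD hf (stdVec i)) (stdVec i))).congr hD ?_
  exact fun x hx => eucLap_eq hD (hf.contDiffOn.of_le (by norm_cast; omega)) hx

lemma polyLap (hD : IsOpen D) {i : ℕ} (hf : BdryClass D (m + 2 * i) j f) :
    BdryClass D m (j - 2 * i) (polyLap i f) := by
  induction i generalizing f j with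
  | zero => exact hf
  | succ i ih =>
    have h1 : BdryClass D (m + 2 * i) (j - 2) (fun x => -_root_.eucLap f x) :=
      ((BdryClass.eucLap (m := m + 2 * i) hD hf).const_mul hD (-1)).congr hD
        fun x _ => by simp
    exact (ih h1).of_le le_rfl (by omega)

lemma bounded (hf : BdryClass D m j f) : ∃ C, 0 ≤ C ∧ ∀ x ∈ D, |f x| ≤ C := by
  obtain ⟨C, hC⟩ := hf.bdd 0 (Nat.zero_le _)
  refine ⟨max C 0, le_max_right _ _, fun x hx => le_max_of_le_left ?_⟩
  simpa using hC x hx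

lemma integrableOn (hD : IsOpen D) (hb : IsBounded D) (hf : BdryClass D m j f) :
    IntegrableOn f D := by
  obtain ⟨C, -, hC⟩ := hf.bounded
  have : IsFiniteMeasure (volume.restrict D) := ⟨by simpa using hb.measure_lt_top⟩
  exact Integrable.of_bound
    (hf.contDiffOn.continuousOn.aestronglyMeasurable hD.measurableSet) C
    ((ae_restrict_iff' hD.measurableSet).2 (Eventually.of_forall hC))

lemma mul_integrableOn (hD : IsOpen D) (hb : IsBounded D) (hf : BdryClass D m j f) {m' j' : ℕ}
    (hg : BdryClass D m' j' g) : IntegrableOn (fun x => f x * g x) D := by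
  obtain ⟨C, -, hC⟩ := hf.bounded
  exact (hg.integrableOn hD hb).bdd_mul
    (hf.contDiffOn.continuousOn.aestronglyMeasurable hD.measurableSet)
    (c := C) ((ae_restrict_iff' hD.measurableSet).2 (Eventually.of_forall hC))

end BdryClass

/-- If `x` is in the open set `D` and `y` is not, the segment from `x` to `y` meets `frontier D`
and a function vanishing there is controlled by its gradient. -/
lemma abs_le_of_tendsto_frontier {D : Set (Euc n)} (hD : IsOpen D) {F : Euc n → ℝ} {L : ℝ}
    (hF : ∀ x ∈ D, DifferentiableAt ℝ F x) (hL : ∀ x ∈ D, ‖fderiv ℝ F x‖ ≤ L)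
    (h0 : ∀ z ∈ frontier D, Tendsto F (nhdsWithin z D) (nhds 0)) {x y : Euc n} (hx : x ∈ D)
    (hy : y ∉ D) : |F x| ≤ L * ‖x - y‖ := by
  set p : ℝ → Euc n := fun t => x + t • (y - x) with hp
  have hpc : Continuous p := by fun_prop
  set S : Set ℝ := Icc 0 1 ∩ p ⁻¹' Dᶜ with hS
  have hSc : IsCompact S := isCompact_Icc.inter_right (hD.isClosed_compl.preimage hpc)
  have hSn : S.Nonempty := ⟨1, by simp, by simpa [hp] using hy⟩
  have hL0 : 0 ≤ L := (norm_nonneg _).trans (hL x hx)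
  set t := sInf S with ht
  have htS : t ∈ S := hSc.sInf_mem hSn
  have hlt : ∀ s, 0 ≤ s → s < t → p s ∈ D := fun s hs hst => by
    by_contra hc
    exact absurd (csInf_le hSc.bddBelow (show s ∈ S from ⟨⟨hs, hst.le.trans htS.1.2⟩, hc⟩))
      (not_le.2 hst)
  have ht0 : 0 < t := by
    rcases htS.1.1.eq_or_lt with h | h
    · exfalso; apply htS.2; rw [← h]; simpa [hp] using hx
    · exact h
  have hest : ∀ s, 0 ≤ s → s < t → |F x| ≤ L * ‖x - y‖ + |F (p s)| := fun s hs hst => by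
    have hseg : segment ℝ x (p s) ⊆ D := by
      rw [segment_eq_image']
      rintro _ ⟨r, hr, rfl⟩
      have : x + r • (p s - x) = p (r * s) := by simp [hp, smul_smul]
      simp only [this]
      exact hlt _ (mul_nonneg hr.1 hs) ((mul_le_of_le_one_left hs hr.2).trans_lt hst)
    have := (convex_segment x (p s)).norm_image_sub_le_of_norm_fderiv_le (𝕜 := ℝ) (f := F) (C := L)
      (fun z hz => hF z (hseg hz)) (fun z hz => hL z (hseg hz)) (left_mem_segment ℝ x (p s))
      (right_mem_segment ℝ x (p s))
    have h2 : ‖p s - x‖ ≤ ‖x - y‖ := by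
      simp only [hp, add_sub_cancel_left, norm_smul, Real.norm_eq_abs, abs_of_nonneg hs]
      rw [norm_sub_rev y x]
      exact mul_le_of_le_one_left (norm_nonneg _) (hst.le.trans htS.1.2)
    have h3 : |F x| ≤ |F (p s)| + |F (p s) - F x| := by
      have := abs_sub_abs_le_abs_sub (F x) (F (p s))
      rw [abs_sub_comm] at this
      linarith
    rw [Real.norm_eq_abs] at this
    nlinarith [mul_le_mul_of_nonneg_left h2 hL0]
  have hcl : Tendsto p (nhdsWithin t (Ico 0 t)) (nhdsWithin (p t) D) := by
    refine tendsto_nhdsWithin_iff.2 ⟨hpc.continuousAt.continuousWithinAt, ?_⟩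
    exact eventually_nhdsWithin_of_forall fun s hs => hlt s hs.1 hs.2
  have hne : (nhdsWithin t (Ico 0 t)).NeBot := by
    rw [← mem_closure_iff_nhdsWithin_neBot, closure_Ico ht0.ne]
    exact right_mem_Icc.2 ht0.le
  have hfr : p t ∈ frontier D := by
    rw [hD.frontier_eq]
    exact ⟨mem_closure_iff_nhdsWithin_neBot.2 (hcl.neBot), htS.2⟩
  have hlim : Tendsto (fun s => L * ‖x - y‖ + |F (p s)|) (nhdsWithin t (Ico 0 t))
      (nhds (L * ‖x - y‖ + |(0 : ℝ)|)) := ((h0 _ hfr).comp hcl).abs.const_add _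
  rw [abs_zero, add_zero] at hlim
  exact ge_of_tendsto hlim (eventually_nhdsWithin_of_forall fun s hs => hest s hs.1 hs.2)

lemma lipschitzWith_indicator {D : Set (Euc n)} (hD : IsOpen D) {F : Euc n → ℝ} {L : ℝ}
    (hL0 : 0 ≤ L)
    (hF : ∀ x ∈ D, DifferentiableAt ℝ F x) (hL : ∀ x ∈ D, ‖fderiv ℝ F x‖ ≤ L)
    (h0 : ∀ z ∈ frontier D, Tendsto F (nhdsWithin z D) (nhds 0)) :
    LipschitzWith (Real.toNNReal L) (D.indicator F) := by
  refine LipschitzWith.of_dist_le_mul fun x y => ?_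
  rw [Real.dist_eq, dist_eq_norm, Real.coe_toNNReal L hL0]
  by_cases hx : x ∈ D <;> by_cases hy : y ∈ D
  · simp only [indicator_of_mem hx, indicator_of_mem hy]
    by_cases hseg : segment ℝ x y ⊆ D
    · have := (convex_segment x y).norm_image_sub_le_of_norm_fderiv_le (𝕜 := ℝ) (f := F) (C := L)
        (fun z hz => hF z (hseg hz)) (fun z hz => hL z (hseg hz)) (right_mem_segment ℝ x y)
        (left_mem_segment ℝ x y)
      simpa using this
    · obtain ⟨z, hz, hzD⟩ := not_subset.1 hseg
      have h1 := abs_le_of_tendsto_frontier hD hF hL h0 hx hzD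
      have h2 := abs_le_of_tendsto_frontier hD hF hL h0 hy hzD
      have h3 := dist_add_dist_of_mem_segment hz
      rw [dist_eq_norm, dist_eq_norm, dist_eq_norm] at h3
      rw [norm_sub_rev y z] at h2
      calc |F x - F y| ≤ |F x| + |F y| := abs_sub _ _
        _ ≤ L * ‖x - z‖ + L * ‖z - y‖ := add_le_add h1 h2
        _ = L * ‖x - y‖ := by rw [← h3]; ring
  · simpa [hx, hy] using abs_le_of_tendsto_frontier hD hF hL h0 hx hy
  · have := abs_le_of_tendsto_frontier hD hF hL h0 hy hx
    rw [norm_sub_rev] at this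
    simpa [hx, hy] using this
  · simpa [hx, hy] using mul_nonneg hL0 (norm_nonneg _)

lemma integral_pd_eq_zero {D : Set (Euc n)} (hD : IsOpen D) (hb : IsBounded D)
    (hnull : volume (frontier D) = 0) {F : Euc n → ℝ} {L : ℝ} (hL0 : 0 ≤ L)
    (hF : ∀ x ∈ D, DifferentiableAt ℝ F x) (hL : ∀ x ∈ D, ‖fderiv ℝ F x‖ ≤ L)
    (h0 : ∀ z ∈ frontier D, Tendsto F (nhdsWithin z D) (nhds 0)) (v : Euc n) :
    ∫ x in D, pd v F x = 0 := by
  have hlip := lipschitzWith_indicator hD hL0 hF hL h0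
  have hsupp : HasCompactSupport (D.indicator F) :=
    HasCompactSupport.of_support_subset_isCompact hb.isCompact_closure
      (support_indicator_subset.trans subset_closure)
  have h1 := LipschitzWith.integral_lineDeriv_mul_eq (μ := volume)
    (LipschitzWith.const (1 : ℝ) : LipschitzWith 0 (fun _ : Euc n => (1 : ℝ))) hlip hsupp (-v)
  have hae : ∀ᵐ x : Euc n, lineDeriv ℝ (D.indicator F) x v = D.indicator (pd v F) x := by
    have : ∀ᵐ x : Euc n, x ∉ frontier D := measure_eq_zero_iff_ae_notMem.1 hnull
    filter_upwards [this] with x hx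
    by_cases hxD : x ∈ D
    · have e : D.indicator F =ᶠ[nhds x] F :=
        (eqOn_indicator).eventuallyEq_of_mem (hD.mem_nhds hxD)
      rw [e.lineDeriv_eq, (hF x hxD).lineDeriv_eq_fderiv, indicator_of_mem hxD]
      rfl
    · have hxc : x ∈ (closure D)ᶜ := fun hc => hx (by rw [hD.frontier_eq]; exact ⟨hc, hxD⟩)
      have e : D.indicator F =ᶠ[nhds x] fun _ => 0 :=
        EqOn.eventuallyEq_of_mem (s := (closure D)ᶜ)
          (fun y hy => indicator_of_notMem (fun h => hy (subset_closure h)) _)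
          (isClosed_closure.isOpen_compl.mem_nhds hxc)
      rw [e.lineDeriv_eq, indicator_of_notMem hxD]
      simp [lineDeriv]
  simp only [neg_neg, mul_one] at h1
  rw [integral_congr_ae hae, integral_indicator hD.measurableSet] at h1
  rw [← h1]
  simp [lineDeriv]

/-- Integration by parts. -/
lemma BdryClass.integral_pd_mul {D : Set (Euc n)} (hD : IsOpen D) (hb : IsBounded D)
    (hnull : volume (frontier D) = 0) {a b : Euc n → ℝ} {ja jb : ℕ} (ha : BdryClass D 1 ja a)
    (hbb : BdryClass D 1 jb b) (hj : 1 ≤ ja ∨ 1 ≤ jb) (v : Euc n) :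
    ∫ x in D, _root_.pd v a x * b x = -∫ x in D, a x * _root_.pd v b x := by
  have da : ∀ x ∈ D, DifferentiableAt ℝ a x := fun x hx =>
    ha.contDiffOn.differentiableAt_of_isOpen hD le_rfl hx
  have db : ∀ x ∈ D, DifferentiableAt ℝ b x := fun x hx =>
    hbb.contDiffOn.differentiableAt_of_isOpen hD le_rfl hx
  obtain ⟨A, hA0, hA⟩ := ha.bounded
  obtain ⟨B, hB0, hB⟩ := hbb.bounded
  obtain ⟨A', hA'⟩ := ha.bdd 1 le_rfl
  obtain ⟨B', hB'⟩ := hbb.bdd 1 le_rfl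
  have hfa : ∀ x ∈ D, ‖fderiv ℝ a x‖ ≤ max A' 0 := fun x hx => by
    rw [← norm_iteratedFDeriv_one]; exact (hA' x hx).trans (le_max_left _ _)
  have hfb : ∀ x ∈ D, ‖fderiv ℝ b x‖ ≤ max B' 0 := fun x hx => by
    rw [← norm_iteratedFDeriv_one]; exact (hB' x hx).trans (le_max_left _ _)
  have h0 : ∀ z ∈ frontier D, Tendsto (fun x => a x * b x) (nhdsWithin z D) (nhds 0) := by
    intro z hz
    rcases hj with h | h
    · have h1 := (ha.tendsto 0 h (Nat.zero_le _) z hz).mul_const B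
      simp only [norm_iteratedFDeriv_zero, Real.norm_eq_abs, zero_mul] at h1
      refine squeeze_zero_norm' (eventually_nhdsWithin_of_forall fun x hx => ?_) h1
      rw [Real.norm_eq_abs, abs_mul]
      exact mul_le_mul_of_nonneg_left (hB x hx) (abs_nonneg _)
    · have h1 := (hbb.tendsto 0 h (Nat.zero_le _) z hz).const_mul A
      simp only [norm_iteratedFDeriv_zero, Real.norm_eq_abs, mul_zero] at h1
      refine squeeze_zero_norm' (eventually_nhdsWithin_of_forall fun x hx => ?_) h1
      rw [Real.norm_eq_abs, abs_mul]
      exact mul_le_mul_of_nonneg_right (hA x hx) (abs_nonneg _)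
  have key := integral_pd_eq_zero hD hb hnull (F := fun x => a x * b x)
    (L := A * max B' 0 + B * max A' 0) (by positivity)
    (fun x hx => (da x hx).mul (db x hx)) (fun x hx => by
      rw [fderiv_fun_mul (da x hx) (db x hx)]
      refine (norm_add_le _ _).trans (add_le_add ?_ ?_)
      · rw [norm_smul]
        exact mul_le_mul (hA x hx) (hfb x hx) (norm_nonneg _) hA0
      · rw [norm_smul]
        exact mul_le_mul (hB x hx) (hfa x hx) (norm_nonneg _) hB0) h0 v
  have hpa := BdryClass.pd (m := 0) hD ha v
  have hpb := BdryClass.pd (m := 0) hD hbb v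
  have e : ∫ x in D, _root_.pd v (fun x => a x * b x) x =
      ∫ x in D, (_root_.pd v a x * b x + a x * _root_.pd v b x) := by
    refine setIntegral_congr_fun hD.measurableSet fun x hx => ?_
    simp only [_root_.pd, fderiv_fun_mul (da x hx) (db x hx)]
    simp
    ring
  rw [e, integral_add (hpa.mul_integrableOn hD hb hbb) (ha.mul_integrableOn hD hb hpb)] at key
  linarith

lemma BdryClass.integral_eucLap_mul {D : Set (Euc n)} (hD : IsOpen D) (hb : IsBounded D)
    (hnull : volume (frontier D) = 0) {a b : Euc n → ℝ} {ja jb : ℕ} (ha : BdryClass D 2 ja a)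
    (hbb : BdryClass D 2 jb b) (h1 : 2 ≤ ja ∨ 1 ≤ jb) (h2 : 1 ≤ ja ∨ 2 ≤ jb) :
    ∫ x in D, _root_.eucLap a x * b x = ∫ x in D, a x * _root_.eucLap b x := by
  have e1 : ∫ x in D, _root_.eucLap a x * b x =
      ∫ x in D, ∑ i : Fin n, _root_.pd (stdVec i) (_root_.pd (stdVec i) a) x * b x :=
    setIntegral_congr_fun hD.measurableSet fun x hx => by
      simp only [eucLap_eq hD ha.contDiffOn hx, Finset.sum_mul]
  have e2 : ∫ x in D, a x * _root_.eucLap b x =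
      ∫ x in D, ∑ i : Fin n, a x * _root_.pd (stdVec i) (_root_.pd (stdVec i) b) x :=
    setIntegral_congr_fun hD.measurableSet fun x hx => by
      simp only [eucLap_eq hD hbb.contDiffOn hx, Finset.mul_sum]
  have pa : ∀ i : Fin n, BdryClass D 1 (ja - 1) (_root_.pd (stdVec i) a) := fun i =>
    BdryClass.pd (m := 1) hD ha _
  have pb : ∀ i : Fin n, BdryClass D 1 (jb - 1) (_root_.pd (stdVec i) b) := fun i =>
    BdryClass.pd (m := 1) hD hbb _
  rw [e1, e2, integral_finsetSum _ fun i _ =>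
      (BdryClass.pd (m := 0) hD (pa i) _).mul_integrableOn hD hb hbb,
    integral_finsetSum _ fun i _ =>
      ha.mul_integrableOn hD hb (BdryClass.pd (m := 0) hD (pb i) _)]
  refine Finset.sum_congr rfl fun i _ => ?_
  rw [(pa i).integral_pd_mul hD hb hnull (hbb.of_le (by norm_num) le_rfl) (by omega),
    (ha.of_le (by norm_num) le_rfl).integral_pd_mul hD hb hnull (pb i) (by omega), neg_neg]

/-- Green's second identity for the polyharmonic operator. -/
lemma BdryClass.integral_polyLap_mul {D : Set (Euc n)} (hD : IsOpen D) (hb : IsBounded D)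
    (hnull : volume (frontier D) = 0) {u v : Euc n → ℝ} {k : ℕ} (hu : BdryClass D (2 * k) k u)
    (hv : BdryClass D (2 * k) k v) :
    ∫ x in D, _root_.polyLap k u x * v x = ∫ x in D, u x * _root_.polyLap k v x := by
  have key : ∀ i ≤ k, ∫ x in D, _root_.polyLap k u x * v x =
      ∫ x in D, _root_.polyLap (k - i) u x * _root_.polyLap i v x := by
    intro i
    induction i with
    | zero => intro _; rfl
    | succ i ih =>
      intro hi
      rw [ih (by omega), show k - i = (k - (i + 1)) + 1 by omega, polyLap_succ' _ u,
        polyLap_succ' i v]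
      have h1 : BdryClass D 2 (k - 2 * (k - (i + 1))) (_root_.polyLap (k - (i + 1)) u) :=
        BdryClass.polyLap hD (hu.of_le (by omega) le_rfl)
      have h2 : BdryClass D 2 (k - 2 * i) (_root_.polyLap i v) :=
        BdryClass.polyLap hD (hv.of_le (by omega) le_rfl)
      have := h1.integral_eucLap_mul hD hb hnull h2 (by omega) (by omega)
      simp only [neg_mul, mul_neg, integral_neg, this]
  simpa [polyLap_zero] using key k le_rfl

end Green

section Pizzetti

variable {n : ℕ}

/-- The polynomial bump `(1 - |z|²)₊^m`. -/
def polyBump (m : ℕ) (z : Euc n) : ℝ := (max 0 (1 - ‖z‖ ^ 2)) ^ m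

lemma polyBump_nonneg (m : ℕ) (z : Euc n) : 0 ≤ polyBump m z := by
  unfold polyBump; positivity

lemma continuous_polyBump (m : ℕ) : Continuous (polyBump m : Euc n → ℝ) := by
  unfold polyBump; fun_prop

lemma polyBump_eq_zero {m : ℕ} (hm : m ≠ 0) {z : Euc n} (hz : 1 ≤ ‖z‖) : polyBump m z = 0 := by
  have : max 0 (1 - ‖z‖ ^ 2) = 0 := max_eq_left (by nlinarith)
  rw [polyBump, this, zero_pow hm]

lemma support_polyBump_subset {m : ℕ} (hm : m ≠ 0) :
    Function.support (polyBump m : Euc n → ℝ) ⊆ closedBall 0 1 := fun z hz => by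
  rw [mem_closedBall_zero_iff]
  by_contra! h
  exact hz (polyBump_eq_zero hm h.le)

lemma hasCompactSupport_polyBump {m : ℕ} (hm : m ≠ 0) :
    HasCompactSupport (polyBump m : Euc n → ℝ) :=
  HasCompactSupport.of_support_subset_isCompact (isCompact_closedBall 0 1)
    (support_polyBump_subset hm)

lemma hasDerivAt_max_zero_pow {m : ℕ} (hm : m ≠ 0) (y : ℝ) :
    HasDerivAt (fun y : ℝ => (max 0 y) ^ (m + 1)) ((m + 1) * (max 0 y) ^ m) y := by
  rcases lt_trichotomy y 0 with h | h | h
  · have e : (fun y : ℝ => (max 0 y) ^ (m + 1)) =ᶠ[nhds y] fun _ => 0 := by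
      filter_upwards [Iio_mem_nhds h] with t ht
      rw [max_eq_left (le_of_lt ht), zero_pow (by omega)]
    rw [max_eq_left h.le, zero_pow hm, mul_zero]
    exact (hasDerivAt_const y (0 : ℝ)).congr_of_eventuallyEq e
  · subst h
    rw [max_self, zero_pow hm, mul_zero]
    have hO : (fun y : ℝ => (max 0 y) ^ (m + 1)) =O[nhds 0] fun y => ‖y - 0‖ ^ (m + 1) := by
      refine Asymptotics.IsBigO.of_bound 1 (Eventually.of_forall fun t => ?_)
      simp only [sub_zero, norm_pow, one_mul, Real.norm_eq_abs, abs_abs]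
      refine pow_le_pow_left₀ (abs_nonneg _) ?_ _
      rw [abs_of_nonneg (le_max_left _ _)]
      exact max_le (abs_nonneg _) (le_abs_self _)
    have := (hO.hasFDerivAt (by omega)).hasDerivAt
    simpa using this
  · have e : (fun y : ℝ => (max 0 y) ^ (m + 1)) =ᶠ[nhds y] fun y => y ^ (m + 1) := by
      filter_upwards [Ioi_mem_nhds h] with t ht
      rw [max_eq_right (le_of_lt ht)]
    rw [max_eq_right h.le]
    have := (hasDerivAt_pow (m + 1) y).congr_of_eventuallyEq e
    simpa using this

lemma contDiff_polyBump {m : ℕ} (hm : m ≠ 0) : ContDiff ℝ 1 (polyBump (m + 1) : Euc n → ℝ) := by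
  have h1 : ContDiff ℝ 1 (fun y : ℝ => (max 0 y) ^ (m + 1)) := by
    rw [contDiff_one_iff_deriv]
    refine ⟨fun y => (hasDerivAt_max_zero_pow hm y).differentiableAt, ?_⟩
    have : deriv (fun y : ℝ => (max 0 y) ^ (m + 1)) = fun y => ((m : ℝ) + 1) * (max 0 y) ^ m :=
      funext fun y => (hasDerivAt_max_zero_pow hm y).deriv
    rw [this]
    fun_prop
  exact h1.comp (contDiff_const.sub (contDiff_norm_sq ℝ))

lemma pd_polyBump {m : ℕ} (hm : m ≠ 0) (v z : Euc n) :
    fderiv ℝ (polyBump (m + 1)) z v = -(2 * (m + 1)) * (inner ℝ z v * polyBump m z) := by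
  have h1 := (hasDerivAt_max_zero_pow hm (1 - ‖z‖ ^ 2)).comp_hasFDerivAt z
    ((hasStrictFDerivAt_norm_sq z).hasFDerivAt.const_sub 1)
  have h2 : HasFDerivAt (polyBump (m + 1)) _ z := h1
  rw [h2.fderiv]
  simp [polyBump]
  ring

/-- The weighted average `∫ (1 - |z|²)₊^m W (x + s z) dz`. -/
def bumpMean (m : ℕ) (W : Euc n → ℝ) (x : Euc n) (s : ℝ) : ℝ :=
  ∫ z, polyBump m z * W (x + s • z)

lemma integrable_polyBump_mul {m : ℕ} (hm : m ≠ 0) {F : Euc n → ℝ} (hF : Continuous F) :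
    Integrable fun z => polyBump m z * F z :=
  ((continuous_polyBump m).mul hF).integrable_of_hasCompactSupport
    (hasCompactSupport_polyBump hm).mul_right

lemma integral_polyBump_pos {m : ℕ} (hm : m ≠ 0) : 0 < ∫ z : Euc n, polyBump m z := by
  refine (continuous_polyBump m).integral_pos_of_hasCompactSupport_nonneg_nonzero
    (hasCompactSupport_polyBump hm) (polyBump_nonneg m) (x := 0) ?_
  simp [polyBump]

lemma hasDerivAt_bumpMean_aux {m : ℕ} (hm : m ≠ 0) {W : Euc n → ℝ} (hW : ContDiff ℝ 1 W)
    (x : Euc n) (s : ℝ) : HasDerivAt (bumpMean m W x)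
      (∫ z, polyBump m z * fderiv ℝ W (x + s • z) z) s := by
  have hc : Continuous (fderiv ℝ W) := hW.continuous_fderiv one_ne_zero
  obtain ⟨K, hK⟩ := (isCompact_closedBall x (|s| + 1)).exists_bound_of_continuousOn hc.continuousOn
  refine (hasDerivAt_integral_of_dominated_loc_of_deriv_le (μ := volume)
    (F := fun s z => polyBump m z * W (x + s • z))
    (F' := fun s z => polyBump m z * fderiv ℝ W (x + s • z) z)
    (bound := fun z => polyBump m z * |K|) (ball_mem_nhds s one_pos) ?_ ?_ ?_ ?_ ?_ ?_).2
  · refine Eventually.of_forall fun t => Continuous.aestronglyMeasurable ?_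
    exact (continuous_polyBump m).mul (hW.continuous.comp (by fun_prop))
  · exact integrable_polyBump_mul hm (hW.continuous.comp (by fun_prop))
  · refine Continuous.aestronglyMeasurable ((continuous_polyBump m).mul ?_)
    exact (hc.comp (by fun_prop)).clm_apply continuous_id
  · refine Eventually.of_forall fun z t ht => ?_
    rw [norm_mul, Real.norm_eq_abs, abs_of_nonneg (polyBump_nonneg m z)]
    rcases le_or_gt 1 ‖z‖ with h | h
    · simp [polyBump_eq_zero hm h]
    · refine mul_le_mul_of_nonneg_left ?_ (polyBump_nonneg m z)
      have ht' : |t| ≤ |s| + 1 := by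
        rw [mem_ball, Real.dist_eq] at ht
        have := abs_sub_abs_le_abs_sub t s
        linarith
      have hmem : x + t • z ∈ closedBall x (|s| + 1) := by
        rw [mem_closedBall, dist_eq_norm, add_sub_cancel_left, norm_smul, Real.norm_eq_abs]
        nlinarith [abs_nonneg t, norm_nonneg z]
      refine (ContinuousLinearMap.le_opNorm _ _).trans ?_
      have h1 := (hK _ hmem).trans (le_abs_self K)
      nlinarith [norm_nonneg z, norm_nonneg (fderiv ℝ W (x + t • z)), abs_nonneg K]
  · exact integrable_polyBump_mul hm continuous_const
  · refine Eventually.of_forall fun z t _ => HasDerivAt.const_mul _ ?_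
    have h1 : HasDerivAt (fun t : ℝ => x + t • z) z t := by
      simpa using ((hasDerivAt_id t).smul_const z).const_add x
    exact ((hW.differentiable one_ne_zero _).hasFDerivAt).comp_hasDerivAt t h1

lemma hasDerivAt_bumpMean {m : ℕ} (hm : m ≠ 0) {W : Euc n → ℝ} (hW : ContDiff ℝ 2 W)
    (x : Euc n) (s : ℝ) : HasDerivAt (bumpMean m W x)
      (s / (2 * (m + 1)) * bumpMean (m + 1) (eucLap W) x s) s := by
  convert hasDerivAt_bumpMean_aux hm (hW.of_le one_le_two) x s using 1
  have hWU : ContDiffOn ℝ 2 W univ := hW.contDiffOn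
  have c1 : ∀ i : Fin n, ContDiff ℝ 1 (pd (stdVec i) W) := fun i =>
    contDiffOn_univ.1 (ContDiffOn.pd (m := 1) isOpen_univ hWU (stdVec i))
  have c2 : ∀ i : Fin n, Continuous (pd (stdVec i) (pd (stdVec i) W)) := fun i =>
    (contDiffOn_univ.1 (ContDiffOn.pd (m := 0) isOpen_univ (c1 i).contDiffOn (stdVec i))).continuous
  have ca : ∀ z : Euc n, HasFDerivAt (fun z : Euc n => x + s • z)
      (s • ContinuousLinearMap.id ℝ (Euc n)) z := fun z =>
    ((hasFDerivAt_id z).const_smul s).const_add x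
  have cc : Continuous (fun z : Euc n => x + s • z) := by fun_prop
  have parts : ∀ i : Fin n, s * ∫ z, polyBump (m + 1) z *
      pd (stdVec i) (pd (stdVec i) W) (x + s • z) =
      (2 * (m + 1)) * ∫ z, polyBump m z * (z i * pd (stdVec i) W (x + s • z)) := by
    intro i
    have hg : ∀ z : Euc n, fderiv ℝ (fun z => pd (stdVec i) W (x + s • z)) z (stdVec i) =
        s * pd (stdVec i) (pd (stdVec i) W) (x + s • z) := fun z => by
      have : HasFDerivAt (fun z => pd (stdVec i) W (x + s • z)) _ z :=
        (((c1 i).differentiable one_ne_zero _).hasFDerivAt).comp z (ca z)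
      rw [this.fderiv]
      simp [pd]
    have hf : ∀ z : Euc n, fderiv ℝ (polyBump (m + 1)) z (stdVec i) =
        -(2 * (m + 1)) * (z i * polyBump m z) := fun z => by
      rw [pd_polyBump hm]; simp [stdVec, EuclideanSpace.inner_single_right]
    have key := integral_mul_fderiv_eq_neg_fderiv_mul_of_integrable (μ := volume) (v := stdVec i)
      (f := (polyBump (m + 1) : Euc n → ℝ)) (g := fun z => pd (stdVec i) W (x + s • z))
      ?_ ?_ ?_ (fun z _ => (contDiff_polyBump hm).differentiable one_ne_zero z)
      (fun z _ => ((c1 i).differentiable one_ne_zero _).comp z (ca z).differentiableAt)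
    · simp only [hg, hf] at key
      rw [← integral_const_mul, ← integral_const_mul]
      calc _ = _ := integral_congr_ae (Eventually.of_forall fun z => by ring)
        _ = _ := key
        _ = _ := by
          rw [← integral_neg]
          exact integral_congr_ae (Eventually.of_forall fun z => by ring)
    · simp only [hf]
      have := (integrable_polyBump_mul hm (F := fun z : Euc n =>
        z i * pd (stdVec i) W (x + s • z))
        ((by fun_prop : Continuous fun z : Euc n => z i).mul
          ((c1 i).continuous.comp cc))).const_mul (-(2 * ((m : ℝ) + 1)))
      refine this.congr (Eventually.of_forall fun z => by ring)
    · simp only [hg]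
      exact integrable_polyBump_mul (Nat.succ_ne_zero m) (((c2 i).comp cc).const_mul s)
    · exact integrable_polyBump_mul (Nat.succ_ne_zero m) ((c1 i).continuous.comp cc)
  have hm' : (2 * ((m : ℝ) + 1)) ≠ 0 := by positivity
  have e1 : bumpMean (m + 1) (eucLap W) x s = ∑ i : Fin n, ∫ z, polyBump (m + 1) z *
      pd (stdVec i) (pd (stdVec i) W) (x + s • z) := by
    rw [← integral_finsetSum]
    · refine integral_congr_ae (Eventually.of_forall fun z => ?_)
      simp only [eucLap_eq isOpen_univ hWU (mem_univ _), Finset.mul_sum]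
    · exact fun i _ => integrable_polyBump_mul (Nat.succ_ne_zero m) ((c2 i).comp cc)
  have e2 : ∫ z, polyBump m z * fderiv ℝ W (x + s • z) z =
      ∑ i : Fin n, ∫ z, polyBump m z * (z i * pd (stdVec i) W (x + s • z)) := by
    rw [← integral_finsetSum]
    · refine integral_congr_ae (Eventually.of_forall fun z => ?_)
      simp only [← Finset.mul_sum]
      congr 1
      have hz : z = ∑ i, z i • stdVec i := by
        conv_lhs => rw [← (EuclideanSpace.basisFun (Fin n) ℝ).sum_repr z]
        simp [stdVec]
      conv_lhs => arg 2; rw [hz]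
      simp [pd]
    · exact fun i _ => integrable_polyBump_mul hm
        ((by fun_prop : Continuous fun z : Euc n => z i).mul ((c1 i).continuous.comp cc))
  rw [e1, e2, Finset.mul_sum]
  refine Finset.sum_congr rfl fun i _ => ?_
  rw [div_mul_eq_mul_div, parts i, mul_div_cancel_left₀ _ hm']

end Pizzetti

section Pizzetti

variable {n : ℕ}

/-- Approximate Pizzetti formula: the weighted averages of `W` are, as functions of the squared
radius, close to a polynomial of degree `< k` if `(-Δ)^k W` is small. -/
lemma exists_bumpMean_approx (k : ℕ) (x : Euc n) {R : ℝ} (hR : 0 ≤ R) {m : ℕ} (hm : m ≠ 0) :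
    ∃ C : ℝ, 0 ≤ C ∧ ∀ W : Euc n → ℝ, ContDiff ℝ (2 * k : ℕ) W → ∀ M : ℝ,
      (∀ y ∈ closedBall x R, |polyLap k W y| ≤ M) →
      ∃ a : ℕ → ℝ, ∀ s ∈ Icc 0 R,
        |bumpMean m W x s - ∑ j ∈ Finset.range k, a j * s ^ (2 * j)| ≤ C * M := by
  induction k generalizing m with
  | zero =>
    refine ⟨∫ z : Euc n, polyBump m z, (integral_polyBump_pos hm).le, fun W hW M hM =>
      ⟨0, fun s hs => ?_⟩⟩
    simp only [Finset.range_zero, Finset.sum_empty, sub_zero]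
    rw [← integral_mul_const, ← Real.norm_eq_abs]
    refine norm_integral_le_of_norm_le (integrable_polyBump_mul hm continuous_const)
      (Eventually.of_forall fun z => ?_)
    rw [norm_mul, Real.norm_eq_abs, abs_of_nonneg (polyBump_nonneg m z)]
    rcases le_or_gt 1 ‖z‖ with h | h
    · simp [polyBump_eq_zero hm h]
    · refine mul_le_mul_of_nonneg_left (hM _ ?_) (polyBump_nonneg m z)
      rw [mem_closedBall, dist_eq_norm, add_sub_cancel_left, norm_smul, Real.norm_eq_abs,
        abs_of_nonneg hs.1]
      nlinarith [hs.1, hs.2, norm_nonneg z]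
  | succ k ih =>
    obtain ⟨C, hC0, hC⟩ := ih (m := m + 1) (Nat.succ_ne_zero m)
    refine ⟨R * (R / (2 * (m + 1)) * C), by positivity, fun W hW M hM => ?_⟩
    have hW2 : ContDiff ℝ 2 W := hW.of_le (by norm_cast; omega)
    have hW' : ContDiff ℝ (2 * k : ℕ) (fun y => -eucLap W y) :=
      (contDiffOn_univ.1 (ContDiffOn.eucLap (m := 2 * k) isOpen_univ hW.contDiffOn)).neg
    obtain ⟨a, ha⟩ := hC _ hW' M hM
    have hneg : ∀ s, bumpMean (m + 1) (fun y => -eucLap W y) x s =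
        -bumpMean (m + 1) (eucLap W) x s := fun s => by
      simp [bumpMean, integral_neg]
    let a' : ℕ → ℝ := fun j => match j with
      | 0 => bumpMean m W x 0
      | j + 1 => -a j / (4 * (m + 1) * (j + 1))
    refine ⟨a', fun s hs => ?_⟩
    set D : ℝ → ℝ := fun s => bumpMean m W x s - ∑ j ∈ Finset.range (k + 1), a' j * s ^ (2 * j)
      with hD
    have hM0 : 0 ≤ M := (abs_nonneg _).trans (hM x (mem_closedBall_self hR))
    have hD0 : D 0 = 0 := by
      simp [hD, Finset.sum_range_succ', a']
    have hD' : ∀ t, HasDerivAt D (t / (2 * (m + 1)) * -(bumpMean (m + 1)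
        (fun y => -eucLap W y) x t - ∑ j ∈ Finset.range k, a j * t ^ (2 * j))) t := by
      intro t
      have h1 : HasDerivAt (fun t : ℝ => ∑ j ∈ Finset.range (k + 1), a' j * t ^ (2 * j))
          (∑ j ∈ Finset.range (k + 1), a' j * ((2 * j : ℕ) * t ^ (2 * j - 1))) t :=
        HasDerivAt.fun_sum fun j _ => (hasDerivAt_pow (2 * j) t).const_mul (a' j)
      refine ((hasDerivAt_bumpMean hm hW2 x t).sub h1).congr_deriv ?_
      rw [hneg, Finset.sum_range_succ', neg_sub, mul_sub, Finset.mul_sum]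
      have : ∀ j ∈ Finset.range k, t / (2 * (m + 1)) * (a j * t ^ (2 * j)) =
          -(a' (j + 1) * ((2 * (j + 1) : ℕ) * t ^ (2 * (j + 1) - 1))) := fun j _ => by
        simp only [a', show 2 * (j + 1) - 1 = 2 * j + 1 by omega]
        push_cast
        field_simp
        ring
      rw [Finset.sum_congr rfl this, Finset.sum_neg_distrib]
      simp
      ring
    have hbound : ∀ t ∈ Icc 0 R, ‖t / (2 * (m + 1)) * -(bumpMean (m + 1)
        (fun y => -eucLap W y) x t - ∑ j ∈ Finset.range k, a j * t ^ (2 * j))‖ ≤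
        R / (2 * (m + 1)) * C * M := fun t ht => by
      rw [norm_mul, norm_neg, Real.norm_eq_abs, Real.norm_eq_abs, mul_assoc, abs_of_nonneg
        (div_nonneg ht.1 (by positivity))]
      exact mul_le_mul (by gcongr; exact ht.2) (ha t ht) (abs_nonneg _) (by positivity)
    have := (convex_Icc 0 R).norm_image_sub_le_of_norm_hasDerivWithin_le
      (fun t _ => (hD' t).hasDerivWithinAt) hbound (left_mem_Icc.2 hR) hs
    rw [hD0, sub_zero, sub_zero, Real.norm_eq_abs, Real.norm_eq_abs, abs_of_nonneg hs.1] at this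
    refine this.trans ?_
    calc _ ≤ R / (2 * (m + 1)) * C * M * R := by gcongr; exact hs.2
      _ = _ := by ring

lemma bumpMean_eq_integral (m : ℕ) (W : Euc n → ℝ) (x : Euc n) {s : ℝ} (hs : 0 < s) :
    bumpMean m W x s = ∫ y, (s ^ n)⁻¹ * polyBump m (s⁻¹ • (y - x)) * W y := by
  have h1 := Measure.integral_comp_inv_smul (volume : Measure (Euc n))
    (fun z => polyBump m z * W (x + s • z)) s
  rw [finrank_euclideanSpace_fin, abs_of_pos (pow_pos hs n), smul_eq_mul] at h1
  have h2 := integral_sub_right_eq_self (μ := (volume : Measure (Euc n)))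
    (fun y => polyBump m (s⁻¹ • y) * W (x + s • (s⁻¹ • y))) x
  simp only [mul_assoc, integral_const_mul]
  rw [bumpMean, eq_inv_mul_iff_mul_eq₀ (pow_pos hs n).ne', ← h1, ← h2]
  simp [smul_smul, hs.ne']

/-- Approximate mean value formula for polyharmonic functions. -/
lemma exists_kernel (k : ℕ) (x : Euc n) {R : ℝ} (hR : 0 < R) :
    ∃ g : Euc n → ℝ, ContDiff ℝ 1 g ∧ Function.support g ⊆ closedBall x R ∧ ∃ C : ℝ, 0 ≤ C ∧
      ∀ W : Euc n → ℝ, ContDiff ℝ (2 * k : ℕ) W → ∀ M : ℝ,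
      (∀ y ∈ closedBall x R, |polyLap k W y| ≤ M) → |W x - ∫ y, g y * W y| ≤ C * M := by
  obtain ⟨C, hC0, hC⟩ := exists_bumpMean_approx (n := n) k x hR.le (m := 2) two_ne_zero
  set c : ℝ := ∫ z : Euc n, polyBump 2 z with hc
  have hc0 : 0 < c := integral_polyBump_pos two_ne_zero
  let r : ℕ → ℝ := fun i => √(i / (k + 1)) * R
  have hr0 : r 0 = 0 := by simp [r]
  have hrp : ∀ i, 0 < r (i + 1) := fun i => by simp only [r]; positivity
  have hrR : ∀ i ≤ k, r i ≤ R := fun i hi => by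
    refine mul_le_of_le_one_left hR.le (Real.sqrt_le_one.2 ?_)
    rw [div_le_one (by positivity)]
    exact_mod_cast hi.trans (Nat.le_succ k)
  let b : ℕ → ℝ := fun i => (-1) ^ (k - i) * (k.choose i : ℝ)
  have hb0 : b 0 = (-1) ^ k := by simp [b]
  have hkill : ∀ j < k, ∑ i ∈ Finset.range (k + 1), b i * r i ^ (2 * j) = 0 := fun j hj => by
    have h1 := congrFun (fwdDiff_iter_pow_eq_zero_of_lt (R := ℝ) hj) 0
    rw [fwdDiff_iter_eq_sum_shift] at h1
    have h2 : ∀ i : ℕ, r i ^ (2 * j) = (R ^ 2 / (k + 1)) ^ j * (i : ℝ) ^ j := fun i => by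
      simp only [r]
      rw [pow_mul, mul_pow, Real.sq_sqrt (by positivity), ← mul_pow]
      congr 1
      ring
    simp only [h2, mul_left_comm (b _), ← Finset.mul_sum]
    simp only [zsmul_eq_mul, nsmul_eq_mul, mul_one, zero_add, Pi.zero_apply] at h1
    push_cast at h1
    rw [h1, mul_zero]
  let g : Euc n → ℝ := fun y => -((-1) ^ k / c) * ∑ i ∈ Finset.range k,
    b (i + 1) * ((r (i + 1) ^ n)⁻¹ * polyBump 2 ((r (i + 1))⁻¹ • (y - x)))
  have hball : ∀ i < k, ∀ y ∉ closedBall x R, polyBump 2 ((r (i + 1))⁻¹ • (y - x)) = 0 :=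
    fun i hi y hy => by
      refine polyBump_eq_zero two_ne_zero ?_
      rw [norm_smul, norm_inv, Real.norm_eq_abs, abs_of_pos (hrp i), ← div_eq_inv_mul,
        one_le_div (hrp i)]
      rw [mem_closedBall, dist_eq_norm, not_le] at hy
      exact (hrR _ hi).trans hy.le
  have hcont : ∀ i, ContDiff ℝ 1 fun y : Euc n => polyBump 2 ((r (i + 1))⁻¹ • (y - x)) :=
    fun i => (contDiff_polyBump one_ne_zero).comp ((contDiff_id.sub contDiff_const).const_smul _)
  refine ⟨g, ?_, ?_, (∑ i ∈ Finset.range (k + 1), |b i|) * C / c, by positivity, ?_⟩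
  · exact contDiff_const.mul (ContDiff.sum fun i _ => contDiff_const.mul
      (contDiff_const.mul (hcont i)))
  · intro y hy
    by_contra hyR
    refine hy ?_
    simp only [g]
    rw [Finset.sum_eq_zero, mul_zero]
    intro i hi
    rw [hball i (Finset.mem_range.1 hi) y hyR, mul_zero, mul_zero]
  · intro W hW M hM
    obtain ⟨a, ha⟩ := hC W hW M hM
    have hM0 : 0 ≤ M := (abs_nonneg _).trans (hM x (mem_closedBall_self hR.le))
    have hzero : ∑ i ∈ Finset.range (k + 1), b i * bumpMean 2 W x (r i) =
        ∑ i ∈ Finset.range (k + 1), b i * (bumpMean 2 W x (r i) -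
          ∑ j ∈ Finset.range k, a j * r i ^ (2 * j)) := by
      simp only [mul_sub, Finset.sum_sub_distrib, Finset.mul_sum]
      rw [Finset.sum_comm (s := Finset.range (k + 1))]
      rw [Finset.sum_eq_zero (s := Finset.range k), sub_zero]
      intro j hj
      simp only [mul_left_comm (b _), ← Finset.mul_sum]
      rw [hkill j (Finset.mem_range.1 hj), mul_zero]
    have hest : |∑ i ∈ Finset.range (k + 1), b i * bumpMean 2 W x (r i)| ≤
        (∑ i ∈ Finset.range (k + 1), |b i|) * (C * M) := by
      rw [hzero, Finset.sum_mul]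
      refine (Finset.abs_sum_le_sum_abs _ _).trans (Finset.sum_le_sum fun i hi => ?_)
      rw [abs_mul]
      refine mul_le_mul_of_nonneg_left (ha _ ⟨?_, hrR i ?_⟩) (abs_nonneg _)
      · simp only [r]; positivity
      · exact Nat.lt_succ_iff.1 (Finset.mem_range.1 hi)
    have h0 : bumpMean 2 W x 0 = c * W x := by
      simp [bumpMean, integral_mul_const, hc]
    have hg : ∫ y, g y * W y = -((-1) ^ k / c) *
        ∑ i ∈ Finset.range k, b (i + 1) * bumpMean 2 W x (r (i + 1)) := by
      have hIntegrable : ∀ i ∈ Finset.range k, Integrable fun y =>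
          b (i + 1) * ((r (i + 1) ^ n)⁻¹ * polyBump 2 ((r (i + 1))⁻¹ • (y - x)) * W y) := by
        intro i hi
        refine Integrable.const_mul ?_ _
        refine (((hcont i).continuous.const_mul _).mul hW.continuous
          ).integrable_of_hasCompactSupport ?_
        refine HasCompactSupport.of_support_subset_isCompact (isCompact_closedBall x R) ?_
        intro y hy
        by_contra hyR
        refine hy ?_
        rw [Pi.mul_apply, hball i (Finset.mem_range.1 hi) y hyR, mul_zero, zero_mul]
      simp only [bumpMean_eq_integral 2 W x (hrp _), ← integral_const_mul]
      rw [← integral_finsetSum _ hIntegrable, ← integral_const_mul]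
      refine integral_congr_ae (Eventually.of_forall fun y => ?_)
      simp only [g, mul_assoc, Finset.sum_mul, Finset.mul_sum]
    have hsq : ((-1 : ℝ) ^ k) * (-1) ^ k = 1 := by rw [← mul_pow]; simp
    have hfin : W x - ∫ y, g y * W y = (-1) ^ k / c *
        ∑ i ∈ Finset.range (k + 1), b i * bumpMean 2 W x (r i) := by
      rw [hg, Finset.sum_range_succ', hr0, h0, hb0]
      have : W x = (-1) ^ k / c * ((-1) ^ k * (c * W x)) := by
        field_simp
        rw [← pow_mul, mul_comm k 2, pow_mul]
        simp
      conv_lhs => rw [this]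
      ring
    rw [hfin, abs_mul, abs_div, abs_pow, abs_neg, abs_one, one_pow, abs_of_pos hc0]
    calc 1 / c * _ ≤ 1 / c * ((∑ i ∈ Finset.range (k + 1), |b i|) * (C * M)) := by gcongr
      _ = _ := by ring

/-- Approximate mean value formula for functions defined on an open set. -/
lemma exists_kernel_of_closedBall_subset (k : ℕ) {x : Euc n} {R : ℝ} (hR : 0 < R)
    {D : Set (Euc n)} (hD : IsOpen D) (hxD : closedBall x (2 * R) ⊆ D) :
    ∃ g : Euc n → ℝ, ContDiff ℝ 1 g ∧ Function.support g ⊆ closedBall x R ∧ ∃ C : ℝ, 0 ≤ C ∧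
      ∀ w : Euc n → ℝ, ContDiffOn ℝ (2 * k : ℕ) w D → ∀ M : ℝ,
      (∀ y ∈ closedBall x R, |polyLap k w y| ≤ M) → |w x - ∫ y in D, g y * w y| ≤ C * M := by
  obtain ⟨g, hg, hsupp, C, hC0, hC⟩ := exists_kernel (n := n) k x hR
  refine ⟨g, hg, hsupp, C, hC0, fun w hw M hM => ?_⟩
  let χ : ContDiffBump x := ⟨3 / 2 * R, 2 * R, by positivity, by linarith⟩
  have hball : closedBall x R ⊆ D := (closedBall_subset_closedBall (by linarith)).trans hxD
  have hχ : ∀ y ∈ ball x (3 / 2 * R), χ y = 1 := fun y hy =>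
    χ.one_of_mem_closedBall (ball_subset_closedBall hy)
  have hbb : closedBall x R ⊆ ball x (3 / 2 * R) := closedBall_subset_ball (by linarith)
  have hWd : ContDiff ℝ (2 * k : ℕ) fun y => χ y * w y := by
    rw [contDiff_iff_contDiffAt]
    intro y
    by_cases hy : y ∈ D
    · exact χ.contDiff.contDiffAt.mul (hw.contDiffAt (hD.mem_nhds hy))
    · have hy' : y ∈ (tsupport χ)ᶜ := fun h => hy (hxD (by rwa [χ.tsupport_eq] at h))
      refine (contDiffAt_const (c := (0 : ℝ))).congr_of_eventuallyEq ?_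
      filter_upwards [(isClosed_tsupport χ).isOpen_compl.mem_nhds hy'] with z hz
      rw [image_eq_zero_of_notMem_tsupport hz, zero_mul]
  have heq : EqOn (fun y => χ y * w y) w (ball x (3 / 2 * R)) := fun y hy => by
    simp only [hχ y hy, one_mul]
  have h1 := hC _ hWd M fun y hy => by
    rw [polyLap_congr isOpen_ball heq k (hbb hy)]
    exact hM y hy
  rw [show χ x * w x = w x from heq (hbb (mem_closedBall_self hR.le))] at h1
  have h2 : ∫ y, g y * (χ y * w y) = ∫ y in D, g y * w y := by
    rw [← integral_indicator hD.measurableSet]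
    refine integral_congr_ae (Eventually.of_forall fun y => ?_)
    by_cases hy : y ∈ closedBall x R
    · simp only [indicator_of_mem (hball hy), hχ y (hbb hy), one_mul]
    · have : g y = 0 := by
        by_contra h
        exact hy (hsupp h)
      simp [this, indicator]
  rwa [h2] at h1

end Pizzetti

section Representation

variable {n k : ℕ} {θ : ℝ} {D : Set (Euc n)} {G : Euc n → Euc n → ℝ}

lemma exists_norm_sub_le_rpow (hb : IsBounded D) (hθ : θ ∈ Ioo (0 : ℝ) 1) :
    ∃ B : ℝ, 0 ≤ B ∧ ∀ x ∈ closure D, ∀ y ∈ closure D, ‖x - y‖ ≤ B * ‖x - y‖ ^ θ := by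
  refine ⟨diam (closure D) ^ (1 - θ), Real.rpow_nonneg diam_nonneg _, fun x hx y hy => ?_⟩
  rcases (norm_nonneg (x - y)).eq_or_lt with h | h
  · rw [← h]; positivity
  · calc ‖x - y‖ = ‖x - y‖ ^ (1 - θ) * ‖x - y‖ ^ θ := by
          rw [← Real.rpow_add h]; simp
      _ ≤ _ := by
        refine mul_le_mul_of_nonneg_right ?_ (by positivity)
        refine Real.rpow_le_rpow h.le ?_ (by linarith [hθ.2])
        rw [← dist_eq_norm]
        exact dist_le_diam_of_mem hb.closure hx hy

lemma ContDiff.exists_holder_bound {F : Type*} [NormedAddCommGroup F] [NormedSpace ℝ F]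
    {f : Euc n → F} (hf : ContDiff ℝ 1 f) (hb : IsBounded D) (hθ : θ ∈ Ioo (0 : ℝ) 1) :
    ∃ C : ℝ, ∀ x ∈ closure D, ∀ y ∈ closure D, ‖f x - f y‖ ≤ C * ‖x - y‖ ^ θ := by
  obtain ⟨B, hB0, hB⟩ := exists_norm_sub_le_rpow hb hθ
  obtain ⟨r, hr⟩ := hb.closure.subset_closedBall 0
  obtain ⟨K, hK⟩ := (isCompact_closedBall (0 : Euc n) r).exists_bound_of_continuousOn
    (hf.continuous_fderiv one_ne_zero).continuousOn
  refine ⟨|K| * B, fun x hx y hy => ?_⟩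
  have := (convex_closedBall (0 : Euc n) r).norm_image_sub_le_of_norm_fderiv_le (𝕜 := ℝ) (f := f)
    (C := |K|) (fun z _ => hf.differentiable one_ne_zero z)
    (fun z hz => (hK z hz).trans (le_abs_self K)) (hr hy) (hr hx)
  refine this.trans ?_
  rw [mul_assoc]
  exact mul_le_mul_of_nonneg_left (hB x hx y hy) (abs_nonneg K)

lemma ContDiff.holderOn {f : Euc n → ℝ} (hf : ContDiff ℝ 1 f) (hb : IsBounded D)
    (hθ : θ ∈ Ioo (0 : ℝ) 1) : HolderOn θ f (closure D) :=
  hf.exists_holder_bound hb hθ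

lemma ContDiffOn.bdryClass {m j : ℕ} (hD : IsOpen D) (hb : IsBounded D)
    (hU : UniqueDiffOn ℝ (closure D)) {u : Euc n → ℝ} (hu : ContDiffOn ℝ m u (closure D))
    (h0 : ∀ i < j, ∀ x ∈ frontier D, iteratedFDerivWithin ℝ i u (closure D) x = 0) :
    BdryClass D m j u := by
  have heq : ∀ i ≤ m, ∀ x ∈ D,
      iteratedFDerivWithin ℝ i u (closure D) x = iteratedFDeriv ℝ i u x := fun i hi x hx => by
    refine iteratedFDerivWithin_eq_iteratedFDeriv hU ?_ (subset_closure hx)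
    exact ((hu.mono subset_closure).contDiffAt (hD.mem_nhds hx)).of_le (by exact_mod_cast hi)
  have hc : ∀ i ≤ m, ContinuousOn (iteratedFDerivWithin ℝ i u (closure D)) (closure D) :=
    fun i hi => hu.continuousOn_iteratedFDerivWithin (by exact_mod_cast hi) hU
  refine ⟨hu.mono subset_closure, fun i hi => ?_, fun i hi him z hz => ?_⟩
  · obtain ⟨C, hC⟩ := hb.isCompact_closure.exists_bound_of_continuousOn (hc i hi)
    exact ⟨C, fun x hx => by rw [← heq i hi x hx]; exact hC x (subset_closure hx)⟩
  · have h1 := ((hc i him z (frontier_subset_closure hz)).mono subset_closure).norm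
    rw [ContinuousWithinAt, h0 i hi z hz, norm_zero] at h1
    refine h1.congr' (eventually_nhdsWithin_of_forall fun x hx => ?_)
    simp only [heq i him x hx]

namespace IsDirichletSolution

lemma bdryClass (hD : IsOpen D) (hb : IsBounded D) (hU : UniqueDiffOn ℝ (closure D))
    {f u : Euc n → ℝ} (h : IsDirichletSolution k θ D f u) : BdryClass D (2 * k) k u := by
  refine ContDiffOn.bdryClass hD hb hU ?_ h.2.2.2
  exact_mod_cast h.1

lemma add (hD : IsOpen D) (hU : UniqueDiffOn ℝ (closure D)) {f g u v : Euc n → ℝ}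
    (hu : IsDirichletSolution k θ D f u) (hv : IsDirichletSolution k θ D g v) :
    IsDirichletSolution k θ D (fun x => f x + g x) (fun x => u x + v x) := by
  obtain ⟨hu1, ⟨C, hC⟩, hu3, hu4⟩ := hu
  obtain ⟨hv1, ⟨C', hC'⟩, hv3, hv4⟩ := hv
  have hu1' : ContDiffOn ℝ (2 * k : ℕ) u (closure D) := by exact_mod_cast hu1
  have hv1' : ContDiffOn ℝ (2 * k : ℕ) v (closure D) := by exact_mod_cast hv1
  have key : ∀ i ≤ 2 * k, ∀ x ∈ closure D,
      iteratedFDerivWithin ℝ i (fun x => u x + v x) (closure D) x =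
      iteratedFDerivWithin ℝ i u (closure D) x + iteratedFDerivWithin ℝ i v (closure D) x :=
    fun i hi x hx => iteratedFDerivWithin_add_apply
      ((hu1' x hx).of_le (by exact_mod_cast hi)) ((hv1' x hx).of_le (by exact_mod_cast hi)) hU hx
  refine ⟨hu1.add hv1, ⟨C + C', fun x hx y hy => ?_⟩, fun x hx => ?_, fun i hi x hx => ?_⟩
  · rw [key _ le_rfl x hx, key _ le_rfl y hy, add_sub_add_comm, add_mul]
    exact (norm_add_le _ _).trans (add_le_add (hC x hx y hy) (hC' x hx y hy))
  · rw [polyLap_add hD (hu1'.mono subset_closure) (hv1'.mono subset_closure) hx]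
    simp only [hu3 x hx, hv3 x hx]
  · rw [key i (by omega) x (frontier_subset_closure hx), hu4 i hi x hx, hv4 i hi x hx, add_zero]

lemma of_contDiff (hD : IsOpen D) (hb : IsBounded D) (hU : UniqueDiffOn ℝ (closure D))
    (hθ : θ ∈ Ioo (0 : ℝ) 1) {b : Euc n → ℝ} (hs : ContDiff ℝ (2 * k + 1 : ℕ) b)
    (hsupp : tsupport b ⊆ D) : IsDirichletSolution k θ D (polyLap k b) b := by
  have heq : ∀ i ≤ 2 * k, ∀ x ∈ closure D,
      iteratedFDerivWithin ℝ i b (closure D) x = iteratedFDeriv ℝ i b x := fun i hi x hx =>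
    iteratedFDerivWithin_eq_iteratedFDeriv hU
      (hs.contDiffAt.of_le (by exact_mod_cast hi.trans (Nat.le_succ _))) hx
  have hs2 : ContDiff ℝ 1 (iteratedFDeriv ℝ (2 * k) b) :=
    hs.iteratedFDeriv_right (by push_cast; rw [add_comm])
  refine ⟨(hs.of_le (by exact_mod_cast Nat.le_succ _)).contDiffOn, ?_, fun x _ => rfl,
    fun i hi x hx => ?_⟩
  · obtain ⟨C, hC⟩ := hs2.exists_holder_bound hb hθ
    refine ⟨C, fun x hx y hy => ?_⟩
    rw [heq _ le_rfl x hx, heq _ le_rfl y hy]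
    exact hC x hx y hy
  · rw [heq i (by omega) x (frontier_subset_closure hx)]
    have hx' : x ∈ (tsupport b)ᶜ := fun h => by
      rw [hD.frontier_eq] at hx
      exact hx.2 (hsupp h)
    have : b =ᶠ[nhds x] fun _ => 0 := by
      filter_upwards [(isClosed_tsupport b).isOpen_compl.mem_nhds hx'] with z hz
      exact image_eq_zero_of_notMem_tsupport hz
    rw [(this.iteratedFDeriv ℝ i).eq_of_nhds, iteratedFDeriv_fun_zero]
    rfl

end IsDirichletSolution

lemma IsGreenFunction.integrableOn (hG : IsGreenFunction k θ D G) (hD : IsOpen D)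
    (hb : IsBounded D) (hU : UniqueDiffOn ℝ (closure D)) (hθ : θ ∈ Ioo (0 : ℝ) 1) {x : Euc n}
    (hx : x ∈ D) : IntegrableOn (G x) D := by
  obtain ⟨r, hr, hrD⟩ := Metric.isOpen_iff.1 hD x hx
  let b : ContDiffBump x := ⟨r / 4, r / 2, by positivity, by linarith⟩
  have hbD : tsupport b ⊆ D := by
    rw [b.tsupport_eq]
    exact (closedBall_subset_ball (by change r / 2 < r; linarith)).trans hrD
  have hb1 : b x = 1 := b.one_of_mem_closedBall (mem_closedBall_self (by positivity))
  have hsol := IsDirichletSolution.of_contDiff (k := k) hD hb hU hθ (b.contDiff) hbD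
  have hfb : ContDiff ℝ 1 (polyLap k b) := contDiffOn_univ.1
    (ContDiffOn.polyLap (m := 1) isOpen_univ (b.contDiff (n := (1 + 2 * k : ℕ))).contDiffOn)
  have hone : ContDiff ℝ 1 (fun _ : Euc n => (1 : ℝ)) := contDiff_const
  have h1 := hG _ hfb.continuous.continuousOn (hfb.holderOn hb hθ)
  have h2 := hG _ hone.continuous.continuousOn (hone.holderOn hb hθ)
  have h3 := hG _ (hfb.add hone).continuous.continuousOn ((hfb.add hone).holderOn hb hθ)
  have hIntegrable : ∀ f : Euc n → ℝ, ∫ y in D, G x y * f y ≠ 0 →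
      IntegrableOn (fun y => G x y * f y) D := fun f hf => by
    by_contra hc
    exact hf (integral_undef hc)
  have e1 : ∫ y in D, G x y * polyLap k b y = 1 := by
    rw [← h1.2 b hsol x (subset_closure hx), hb1]
  by_cases h0 : ∫ y in D, G x y * (1 : ℝ) = 0
  · have e3 := h3.2 _ (hsol.add hD hU h2.1) x (subset_closure hx)
    simp only [hb1, h0, add_zero] at e3
    have i1 := hIntegrable _ (by rw [e1]; exact one_ne_zero)
    have i3 := hIntegrable (fun y => polyLap k b y + 1) (by
      have : ∫ y in D, G x y * (polyLap k b y + 1) = 1 := e3.symm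
      rw [this]; exact one_ne_zero)
    refine (i3.sub i1).congr (Eventually.of_forall fun y => ?_)
    simp only [Pi.sub_apply]
    ring
  · simpa using hIntegrable _ h0

lemma exists_contDiff_approx (hD : IsOpen D) {f : Euc n → ℝ} {M : ℝ} (hM : 0 ≤ M)
    (hf : ContinuousOn f D) (hfM : ∀ y ∈ D, |f y| ≤ M) :
    ∃ F : ℕ → Euc n → ℝ, (∀ j, ContDiff ℝ 1 (F j)) ∧ (∀ j y, |F j y| ≤ M) ∧
      ∀ K ⊆ D, IsCompact K → ∀ e > 0, ∀ᶠ j in atTop, ∀ y ∈ K, |f y - F j y| ≤ e := by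
  set g : Euc n → ℝ := D.indicator f with hg
  have hgm : AEStronglyMeasurable g volume :=
    (aestronglyMeasurable_indicator_iff hD.measurableSet).2
      (hf.aestronglyMeasurable hD.measurableSet)
  have hgM : ∀ y, |g y| ≤ M := fun y => by
    by_cases hy : y ∈ D
    · simpa [hg, hy] using hfM y hy
    · simpa [hg, hy] using hM
  have hgl : LocallyIntegrable g := by
    refine LocallyIntegrable.mono (locallyIntegrable_const M) hgm (Eventually.of_forall fun y => ?_)
    rw [Real.norm_eq_abs, Real.norm_eq_abs, abs_of_nonneg hM]
    exact hgM y
  let χ : ℕ → ContDiffBump (0 : Euc n) := fun j =>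
    ⟨1 / (2 * ((j : ℝ) + 1)), 1 / ((j : ℝ) + 1), by positivity,
      one_div_lt_one_div_of_lt (by positivity) (by linarith [(Nat.cast_nonneg j : (0 : ℝ) ≤ j)])⟩
  refine ⟨fun j => convolution ((χ j).normed volume) g (ContinuousLinearMap.lsmul ℝ ℝ) volume,
    fun j => ?_, fun j y => ?_, fun K hKD hK e he => ?_⟩
  · exact (χ j).hasCompactSupport_normed.contDiff_convolution_left (n := 1) _
      (χ j).contDiff_normed hgl
  · have := dist_convolution_le (x₀ := y) (R := (χ j).rOut) (z₀ := (0 : ℝ)) hM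
      (χ j).support_normed_eq.subset (χ j).nonneg_normed (χ j).integral_normed hgm
      (fun z _ => by rw [dist_zero_right]; exact hgM z)
    rwa [dist_zero_right] at this
  · obtain ⟨δ, hδ, hδD⟩ := hK.exists_cthickening_subset_open hD hKD
    have huc := hK.cthickening (r := δ).uniformContinuousOn_of_continuous (hf.mono hδD)
    obtain ⟨η, hη, h⟩ := Metric.uniformContinuousOn_iff_le.1 huc e he
    have hlim := (tendsto_one_div_add_atTop_nhds_zero_nat (𝕜 := ℝ)).eventually
      (Iio_mem_nhds (lt_min hδ hη))
    filter_upwards [hlim] with j hj y hy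
    have hjr : (χ j).rOut < min δ η := hj
    have := (χ j).dist_normed_convolution_le (x₀ := y) (ε := e) hgm fun z hz => by
      have hzy : dist z y ≤ min δ η := (mem_ball.1 hz).le.trans hjr.le
      have hz' : z ∈ cthickening δ K := mem_cthickening_of_dist_le z y δ K hy
        (hzy.trans (min_le_left _ _))
      have hy' : y ∈ cthickening δ K := self_subset_cthickening K hy
      simp only [hg, indicator_of_mem (hδD hz'), indicator_of_mem (hδD hy')]
      exact h z hz' y hy' (hzy.trans (min_le_right _ _))
    rw [dist_comm, Real.dist_eq] at this
    simpa only [hg, indicator_of_mem (hKD hy)] using this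

/-- The Green representation formula for functions of class `C^{2k}`. -/
lemma IsGreenFunction.representation (hG : IsGreenFunction k θ D G) (hD : IsOpen D)
    (hb : IsBounded D) (hnull : volume (frontier D) = 0) (hU : UniqueDiffOn ℝ (closure D))
    (hθ : θ ∈ Ioo (0 : ℝ) 1) {u : Euc n → ℝ} (hu : BdryClass D (2 * k) k u) {x : Euc n}
    (hx : x ∈ D) : u x = ∫ y in D, G x y * polyLap k u y := by
  have hGx := hG.integrableOn hD hb hU hθ hx
  have hfB : BdryClass D 0 (k - 2 * k) (polyLap k u) :=
    BdryClass.polyLap hD (hu.of_le (by omega) le_rfl)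
  set f := polyLap k u with hf
  obtain ⟨M, hM0, hM⟩ := hfB.bounded
  have hfc : ContinuousOn f D := hfB.contDiffOn.continuousOn
  obtain ⟨F, hF1, hFM, hFlim⟩ := exists_contDiff_approx hD hM0 hfc hM
  have hpt : ∀ y ∈ D, Tendsto (fun j => F j y) atTop (nhds (f y)) := fun y hy => by
    rw [Metric.tendsto_nhds]
    intro e he
    filter_upwards [hFlim {y} (by simpa using hy) isCompact_singleton (e / 2) (by positivity)]
      with j hj
    have := hj y rfl
    rw [dist_comm, Real.dist_eq]
    linarith
  obtain ⟨r, hr, hrD⟩ := Metric.isOpen_iff.1 hD x hx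
  have hball : closedBall x (2 * (r / 3)) ⊆ D :=
    (closedBall_subset_ball (by linarith)).trans hrD
  have hball' : closedBall x (r / 3) ⊆ D :=
    (closedBall_subset_closedBall (by linarith)).trans hball
  obtain ⟨g, hg1, -, C, hC0, hC⟩ :=
    exists_kernel_of_closedBall_subset k (by positivity : 0 < r / 3) hD hball
  have hψ := (hG g hg1.continuous.continuousOn (hg1.holderOn hb hθ)).1
  set ψ : Euc n → ℝ := fun x => ∫ y in D, G x y * g y
  have hψB : BdryClass D (2 * k) k ψ := hψ.bdryClass hD hb hU
  have hsol := fun j => (hG (F j) (hF1 j).continuous.continuousOn ((hF1 j).holderOn hb hθ)).1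
  set U : ℕ → Euc n → ℝ := fun j x => ∫ y in D, G x y * F j y with hUdef
  have hUB : ∀ j, BdryClass D (2 * k) k (U j) := fun j => (hsol j).bdryClass hD hb hU
  have hwB : ∀ j, BdryClass D (2 * k) k (fun y => u y + -1 * U j y) := fun j =>
    hu.add hD ((hUB j).const_mul hD (-1))
  have hwL : ∀ j, ∀ y ∈ D, polyLap k (fun y => u y + -1 * U j y) y = f y - F j y :=
    fun j y hy => by
      rw [polyLap_add hD hu.contDiffOn ((hUB j).const_mul hD (-1)).contDiffOn hy]
      have h1 := polyLap_const_mul hD (hUB j).contDiffOn (-1) hy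
      have h2 : polyLap k (U j) y = F j y := (hsol j).2.2.1 y hy
      simp only [h2] at h1
      simp only [h1, hf]
      ring
  have hmeas : ∀ j, AEStronglyMeasurable (F j) (volume.restrict D) := fun j =>
    (hF1 j).continuous.aestronglyMeasurable
  have hfm : AEStronglyMeasurable f (volume.restrict D) :=
    hfc.aestronglyMeasurable hD.measurableSet
  have hpair : Tendsto (fun j => ∫ y in D, g y * (u y + -1 * U j y)) atTop (nhds 0) := by
    have e : ∀ j, ∫ y in D, g y * (u y + -1 * U j y) = ∫ y in D, ψ y * (f y - F j y) :=
      fun j => by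
        calc _ = ∫ y in D, polyLap k ψ y * (u y + -1 * U j y) :=
              setIntegral_congr_fun hD.measurableSet fun y hy => by simp only [hψ.2.2.1 y hy]
          _ = ∫ y in D, ψ y * polyLap k (fun y => u y + -1 * U j y) y :=
              hψB.integral_polyLap_mul hD hb hnull (hwB j)
          _ = _ := setIntegral_congr_fun hD.measurableSet fun y hy => by simp only [hwL j y hy]
    simp only [e]
    rw [show (0 : ℝ) = ∫ y in D, (0 : ℝ) by simp]
    have hψi := hψB.integrableOn hD hb
    refine tendsto_integral_of_dominated_convergence (fun y => |ψ y| * (2 * M)) (fun j => ?_)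
      (hψi.abs.mul_const _) (fun j => ?_) ?_
    · exact hψi.aestronglyMeasurable.mul (hfm.sub (hmeas j))
    · refine (ae_restrict_iff' hD.measurableSet).2 (Eventually.of_forall fun y hy => ?_)
      rw [norm_mul, Real.norm_eq_abs, Real.norm_eq_abs]
      refine mul_le_mul_of_nonneg_left ?_ (abs_nonneg _)
      refine (abs_sub _ _).trans ?_
      linarith [hM y hy, hFM j y]
    · refine (ae_restrict_iff' hD.measurableSet).2 (Eventually.of_forall fun y hy => ?_)
      simpa using ((hpt y hy).const_sub (f y)).const_mul (ψ y)
  have hlim1 : Tendsto (fun j => u x - U j x) atTop (nhds 0) := by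
    rw [Metric.tendsto_nhds]
    intro e he
    rw [Metric.tendsto_nhds] at hpair
    filter_upwards [hpair (e / 2) (by positivity), hFlim _ hball' (isCompact_closedBall x (r / 3))
      (e / (4 * (C + 1))) (by positivity)] with j h1 h2
    have h3 := hC _ (hwB j).contDiffOn (e / (4 * (C + 1))) fun y hy => by
      rw [hwL j y (hball' hy)]
      exact h2 y hy
    have h4 : C * (e / (4 * (C + 1))) ≤ e / 4 := by
      rw [mul_div_assoc', div_le_div_iff₀ (by positivity) (by norm_num)]
      nlinarith
    rw [dist_zero_right, Real.norm_eq_abs] at h1 ⊢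
    have h5 : u x + -1 * U j x = u x - U j x := by ring
    rw [h5] at h3
    have h6 := abs_sub_abs_le_abs_sub (u x - U j x) (∫ y in D, g y * (u y + -1 * U j y))
    linarith
  have hlim2 : Tendsto (fun j => U j x) atTop (nhds (∫ y in D, G x y * f y)) := by
    simp only [hUdef]
    refine tendsto_integral_of_dominated_convergence (fun y => |G x y| * M) (fun j => ?_)
      (hGx.abs.mul_const _) (fun j => Eventually.of_forall fun y => ?_) ?_
    · exact hGx.aestronglyMeasurable.mul (hmeas j)
    · rw [norm_mul, Real.norm_eq_abs, Real.norm_eq_abs]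
      exact mul_le_mul_of_nonneg_left (hFM j y) (abs_nonneg _)
    · refine (ae_restrict_iff' hD.measurableSet).2 (Eventually.of_forall fun y hy => ?_)
      exact (hpt y hy).const_mul (G x y)
  have := tendsto_nhds_unique hlim1 (hlim2.const_sub (u x))
  linarith

end Representation

section InvertedDomain

variable {n : ℕ}

lemma norm_kap {ε : ℝ} (hε : 0 < ε) (x : Euc n) : ‖kap ε x‖ = ε / ‖x‖ := by
  rcases eq_or_ne x 0 with rfl | hx
  · simp [kap, invMap]
  have h0 : 0 < ‖x‖ := norm_pos_iff.2 hx
  simp only [kap, invMap, norm_smul, Real.norm_eq_abs, abs_of_pos hε, abs_inv, abs_pow, abs_norm]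
  field_simp

lemma kap_kap {ε : ℝ} (hε : 0 < ε) (x : Euc n) : kap ε (kap ε x) = x := by
  rcases eq_or_ne x 0 with rfl | hx
  · simp [kap, invMap]
  have h0 : ‖x‖ ≠ 0 := norm_ne_zero_iff.2 hx
  have h : kap ε (kap ε x) = (ε * (‖kap ε x‖ ^ 2)⁻¹ * (ε * (‖x‖ ^ 2)⁻¹)) • x := by
    simp only [kap, invMap, smul_smul, mul_assoc]
  rw [h, norm_kap hε]
  convert one_smul ℝ x using 2
  field_simp

lemma kap_ne_zero {ε : ℝ} (hε : 0 < ε) {x : Euc n} (hx : x ≠ 0) : kap ε x ≠ 0 := by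
  rw [← norm_pos_iff, norm_kap hε]
  exact div_pos hε (norm_pos_iff.2 hx)

lemma kap_one : (kap 1 : Euc n → Euc n) = invMap := by
  funext x; simp [kap]

lemma invMap_invMap (x : Euc n) : invMap (invMap x) = x := by
  simpa only [kap_one] using kap_kap one_pos x

lemma norm_invMap (x : Euc n) : ‖invMap x‖ = ‖x‖⁻¹ := by
  simpa only [kap_one, one_div] using norm_kap one_pos x

lemma isOpen_invMap_preimage {V : Set (Euc n)} (hV : IsOpen V) :
    IsOpen {x : Euc n | x ≠ 0 ∧ invMap x ∈ V} := by
  simpa only [kap_one] using isOpen_kap_preimage 1 hV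

variable {ω : Set (Euc n)}

lemma mem_omegaZero_iff {z : Euc n} :
    z ∈ omegaZero ω ↔ z = 0 ∨ invMap z ∉ closure ω := by
  constructor
  · rintro (⟨y, hy, rfl⟩ | h)
    · right; rwa [invMap_invMap]
    · exact Or.inl h
  · rintro (h | h)
    · exact Or.inr h
    · exact Or.inl ⟨_, h, invMap_invMap z⟩

lemma omegaZero_eq_union {r : ℝ} (hr : 0 < r)
    (hω : closure ω ⊆ closedBall 0 r) :
    omegaZero ω = {z : Euc n | z ≠ 0 ∧ invMap z ∈ (closure ω)ᶜ} ∪ ball 0 r⁻¹ := by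
  ext z
  rw [mem_omegaZero_iff]
  rcases eq_or_ne z 0 with rfl | hz
  · simp [hr]
  · simp only [hz, false_or, mem_union, mem_ofPred_eq, ne_eq, not_false_eq_true, true_and,
      mem_compl_iff, mem_ball_zero_iff]
    refine ⟨Or.inl, fun h => h.elim id fun h h1 => ?_⟩
    have h2 := mem_closedBall_zero_iff.1 (hω h1)
    rw [norm_invMap] at h2
    have h3 : 0 < ‖z‖ := norm_pos_iff.2 hz
    have := (inv_le_comm₀ h3 hr).1 h2
    linarith

lemma exists_closure_subset_closedBall (hb : IsBounded ω) :
    ∃ r : ℝ, 0 < r ∧ closure ω ⊆ closedBall 0 r := by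
  obtain ⟨r, hr0, hr⟩ := hb.closure.subset_closedBall_lt 0 0
  exact ⟨r, hr0, hr⟩

lemma isOpen_omegaZero (hb : IsBounded ω) : IsOpen (omegaZero ω) := by
  obtain ⟨r, hr, h⟩ := exists_closure_subset_closedBall hb
  rw [omegaZero_eq_union hr h]
  exact (isOpen_invMap_preimage isClosed_closure.isOpen_compl).union isOpen_ball

lemma isBounded_omegaZero (hω : IsOpen ω) (h0 : (0 : Euc n) ∈ ω) : IsBounded (omegaZero ω) := by
  obtain ⟨δ, hδ, h⟩ := Metric.isOpen_iff.1 hω 0 h0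
  refine isBounded_closedBall.subset (s := omegaZero ω) (t := closedBall 0 δ⁻¹) fun z hz => ?_
  rw [mem_closedBall_zero_iff]
  rcases mem_omegaZero_iff.1 hz with rfl | hz
  · simpa using hδ.le
  have h1 : δ ≤ ‖invMap z‖ := by
    by_contra! hlt
    exact hz (subset_closure (h (mem_ball_zero_iff.2 hlt)))
  rw [norm_invMap] at h1
  have : 0 < ‖z‖ := inv_pos.1 (hδ.trans_le h1)
  exact (le_inv_comm₀ hδ this).1 h1

lemma invMap_notMem_of_mem_closure_omegaZero (hω : IsOpen ω) {z : Euc n}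
    (hz : z ∈ closure (omegaZero ω)) (hz0 : z ≠ 0) : invMap z ∉ ω := by
  intro h
  obtain ⟨w, ⟨hw0, hw⟩, hwD⟩ := mem_closure_iff.1 hz _ (isOpen_invMap_preimage hω) ⟨hz0, h⟩
  rcases mem_omegaZero_iff.1 hwD with h | h
  · exact hw0 h
  · exact h (subset_closure hw)

lemma mem_frontier_omegaZero (hω : IsOpen ω) (hb : IsBounded ω)
    {z : Euc n} (hz : z ∈ frontier (omegaZero ω)) : z ≠ 0 ∧ invMap z ∈ frontier ω := by
  rw [(isOpen_omegaZero hb).frontier_eq] at hz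
  have hz0 : z ≠ 0 := fun h => hz.2 (mem_omegaZero_iff.2 (Or.inl h))
  refine ⟨hz0, ?_⟩
  rw [hω.frontier_eq]
  refine ⟨?_, invMap_notMem_of_mem_closure_omegaZero hω hz.1 hz0⟩
  by_contra h
  exact hz.2 (mem_omegaZero_iff.2 (Or.inr h))

/-- The regular zero set of a continuously differentiable function is a null set. -/
lemma volume_regular_zero_set {ρ : Euc n → ℝ} (hρ : ContDiff ℝ 1 ρ) {S : Set (Euc n)}
    (h0 : ∀ x ∈ S, ρ x = 0) (h1 : ∀ x ∈ S, fderiv ℝ ρ x ≠ 0) : volume S = 0 := by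
  refine measure_null_of_locally_null S fun x hx => ?_
  obtain ⟨K, t, ht, hL⟩ := hρ.contDiffAt (x := x).exists_lipschitzOnWith
  obtain ⟨U, hUt, hU, hxU⟩ := _root_.mem_nhds_iff.1 ht
  have hL' : LipschitzOnWith K (fun y => |ρ y|) U := fun y hy z hz =>
    (by
      have := (hL.mono hUt) hy hz
      refine le_trans ?_ this
      rw [edist_dist, edist_dist]
      exact ENNReal.ofReal_le_ofReal (by
        rw [Real.dist_eq, Real.dist_eq]; exact abs_abs_sub_abs_le _ _))
  refine ⟨S ∩ U, inter_mem_nhdsWithin S (hU.mem_nhds hxU), ?_⟩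
  have h2 := hL'.ae_differentiableWithinAt (μ := volume) hU.measurableSet
  rw [ae_restrict_iff' hU.measurableSet] at h2
  refine measure_mono_null (t := {y | ¬(y ∈ U → _)}) ?_ (ae_iff.1 h2)
  intro y hy hy'
  have hd : DifferentiableAt ℝ (fun y => |ρ y|) y :=
    (hy' hy.2).differentiableAt (hU.mem_nhds hy.2)
  have hm : IsLocalMin (fun y => |ρ y|) y := Filter.Eventually.of_forall fun z => by
    simp [h0 y hy.1]
  have h3 : HasFDerivAt (fun y => |ρ y|) (0 : Euc n →L[ℝ] ℝ) y := by
    rw [← hm.fderiv_eq_zero]; exact hd.hasFDerivAt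
  refine h1 y hy.1 (HasFDerivAt.fderiv ?_)
  rw [hasFDerivAt_iff_isLittleO_nhds_zero] at h3 ⊢
  refine Asymptotics.IsLittleO.of_norm_left ?_
  simpa [h0 y hy.1] using h3.norm_left

lemma uniqueDiffWithinAt_of_pos_subset {H : Euc n → ℝ} {L : Euc n →L[ℝ] ℝ} {z : Euc n}
    {S : Set (Euc n)} (hH : HasFDerivAt H L z) (hz : H z = 0) (hL : L ≠ 0)
    (hS : ∀ᶠ w in nhds z, 0 < H w → w ∈ S) : UniqueDiffWithinAt ℝ S z := by
  obtain ⟨v₀, hv₀⟩ : ∃ v, 0 < L v := by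
    by_contra! h
    refine hL (ContinuousLinearMap.ext fun v => le_antisymm (h v) ?_)
    have := h (-v)
    simp at this
    simpa using this
  have hev : ∀ v, 0 < L v → ∀ᶠ c in nhdsWithin (0 : ℝ) (Ioi 0), z + c • v ∈ S := fun v hv => by
    have ht : Tendsto (fun c : ℝ => z + c • v) (nhds 0) (nhds z) := by
      have : Continuous fun c : ℝ => z + c • v := by fun_prop
      simpa using this.tendsto 0
    have hd : HasDerivAt (fun c : ℝ => H (z + c • v)) (L v) 0 := by
      have h1 : HasDerivAt (fun c : ℝ => z + c • v) v 0 := by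
        simpa using ((hasDerivAt_id (0 : ℝ)).smul_const v).const_add z
      have h2 : HasFDerivAt H L (z + (0 : ℝ) • v) := by simpa using hH
      exact h2.comp_hasDerivAt 0 h1
    have hs := (hasDerivAt_iff_tendsto_slope.1 hd).mono_left
      (nhdsWithin_mono _ (fun c (hc : c ∈ Ioi (0 : ℝ)) => (ne_of_gt hc : c ≠ 0)))
    filter_upwards [hs.eventually (lt_mem_nhds hv), (ht.mono_left nhdsWithin_le_nhds).eventually hS,
      self_mem_nhdsWithin] with c hc hc' hc0
    refine hc' ?_
    have hc0 : 0 < c := hc0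
    rw [slope_def_field] at hc
    simp only [zero_smul, add_zero, hz, sub_zero] at hc
    exact (div_pos_iff_of_pos_right hc0).1 hc
  have hcone : ∀ v, 0 < L v → v ∈ tangentConeAt ℝ S z := fun v hv => by
    refine mem_tangentConeAt_of_add_smul_mem (l := nhdsWithin (0 : ℝ) (Ioi 0)) (c := id) ?_
      (hev v hv)
    exact tendsto_id.mono_left le_rfl |>.mono_right
      (nhdsWithin_mono _ (fun c (hc : c ∈ Ioi (0 : ℝ)) => (ne_of_gt hc : c ≠ 0)))
  refine ⟨?_, ?_⟩
  · have : Submodule.span ℝ (tangentConeAt ℝ S z) = ⊤ := by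
      refine eq_top_iff.2 fun w _ => ?_
      obtain ⟨c, hc⟩ : ∃ c : ℝ, 0 < L (w + c • v₀) := by
        refine ⟨(1 - L w) / L v₀, ?_⟩
        simp [div_mul_cancel₀ _ hv₀.ne']
      have h1 := Submodule.subset_span (R := ℝ) (hcone _ hc)
      have h2 := Submodule.smul_mem _ c (Submodule.subset_span (R := ℝ) (hcone _ hv₀))
      simpa using Submodule.sub_mem _ h1 h2
    rw [this]
    exact dense_univ
  · have ht : Tendsto (fun c : ℝ => z + c • v₀) (nhdsWithin 0 (Ioi 0)) (nhds z) := by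
      have : Continuous fun c : ℝ => z + c • v₀ := by fun_prop
      simpa using (this.tendsto 0).mono_left (nhdsWithin_le_nhds (s := Ioi (0 : ℝ)))
    exact mem_closure_of_tendsto ht (hev v₀ hv₀)

end InvertedDomain

section RegularBoundary

variable {n : ℕ} {ω : Set (Euc n)} {ρ : Euc n → ℝ}

lemma frontier_smul_set {ε : ℝ} (hε : ε ≠ 0) (s : Set (Euc n)) :
    frontier (ε • s) = ε • frontier s :=
  ((Homeomorph.smulOfNeZero ε hε).image_frontier s).symm

lemma mem_frontier_smul_set {ε : ℝ} (hε : ε ≠ 0) {s : Set (Euc n)} {x : Euc n} :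
    ε • x ∈ frontier (ε • s) ↔ x ∈ frontier s := by
  rw [frontier_smul_set hε, smul_mem_smul_set_iff₀ hε]

lemma kap_mem_smul_set {ε : ℝ} (hε : ε ≠ 0) {s : Set (Euc n)} {x : Euc n} :
    kap ε x ∈ ε • s ↔ invMap x ∈ s := smul_mem_smul_set_iff₀ hε _ _

lemma pos_imp_notMem_closure (h1 : ω = {x | ρ x < 0}) (h2 : frontier ω = {x | ρ x = 0})
    {x : Euc n} (hx : 0 < ρ x) : x ∉ closure ω := by
  rw [closure_eq_self_union_frontier, h2, h1]
  rintro (h | h)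
  · exact lt_asymm hx h
  · exact hx.ne' h

lemma fderiv_comp_fderiv_kap {ε : ℝ} (hε : 0 < ε) {x : Euc n} (hx : x ≠ 0) :
    (fderiv ℝ (kap ε) x).comp (fderiv ℝ (kap ε) (kap ε x)) = ContinuousLinearMap.id ℝ (Euc n) := by
  have hy := kap_ne_zero hε hx
  have h1 : HasFDerivAt (kap ε) (fderiv ℝ (kap ε) x) (kap ε (kap ε x)) := by
    rw [kap_kap hε]; exact (hasFDerivAt_kap hx ε).differentiableAt.hasFDerivAt
  have h2 := h1.comp _ (hasFDerivAt_kap hy ε).differentiableAt.hasFDerivAt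
  have h3 : (kap ε ∘ kap ε : Euc n → Euc n) = id := funext fun y => kap_kap hε y
  rw [h3] at h2
  exact h2.unique (hasFDerivAt_id _)

lemma uniqueDiffOn_closure_omegaZero (hρ : ContDiff ℝ 1 ρ) (hω : IsOpen ω) (hb : IsBounded ω)
    (h1 : ω = {x | ρ x < 0}) (h2 : frontier ω = {x | ρ x = 0})
    (h3 : ∀ x ∈ frontier ω, fderiv ℝ ρ x ≠ 0) : UniqueDiffOn ℝ (closure (omegaZero ω)) := by
  intro z hz
  have hD := isOpen_omegaZero hb
  by_cases hzD : z ∈ omegaZero ω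
  · exact (hD.uniqueDiffWithinAt hzD).mono subset_closure
  obtain ⟨hz0, hzf⟩ := mem_frontier_omegaZero hω hb (by rw [hD.frontier_eq]; exact ⟨hz, hzD⟩)
  have hK : HasFDerivAt invMap (fderiv ℝ invMap z) z := by
    have := (hasFDerivAt_kap hz0 1).differentiableAt.hasFDerivAt
    rwa [kap_one] at this
  have hd := (hρ.differentiable one_ne_zero (invMap z)).hasFDerivAt.comp z hK
  refine uniqueDiffWithinAt_of_pos_subset hd (by simpa [h2] using hzf) (fun h0 => ?_)
    (Eventually.of_forall fun w hw => subset_closure (mem_omegaZero_iff.2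
      (Or.inr (pos_imp_notMem_closure h1 h2 hw))))
  refine h3 _ hzf ?_
  have h4 := fderiv_comp_fderiv_kap one_pos hz0
  rw [kap_one] at h4
  have h5 := congrArg (fun L : Euc n →L[ℝ] ℝ => L.comp (fderiv ℝ invMap (invMap z))) h0
  simpa [ContinuousLinearMap.comp_assoc, h4] using h5

lemma uniqueDiffOn_compl_smul (hρ : ContDiff ℝ 1 ρ) (hω : IsOpen ω)
    (h1 : ω = {x | ρ x < 0}) (h2 : frontier ω = {x | ρ x = 0})
    (h3 : ∀ x ∈ frontier ω, fderiv ℝ ρ x ≠ 0) {ε : ℝ} (hε : ε ≠ 0) :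
    UniqueDiffOn ℝ (ε • ω)ᶜ := by
  intro x hx
  obtain ⟨z, rfl⟩ : ∃ z, ε • z = x := ⟨ε⁻¹ • x, smul_inv_smul₀ hε x⟩
  have hz : z ∉ ω := fun h => hx (smul_mem_smul_set h)
  by_cases hzf : z ∈ closure ω
  · have hzf : z ∈ frontier ω := by rw [hω.frontier_eq]; exact ⟨hzf, hz⟩
    have hK : HasFDerivAt (fun w : Euc n => ε⁻¹ • w) (ε⁻¹ • ContinuousLinearMap.id ℝ (Euc n))
        (ε • z) := (hasFDerivAt_id _).const_smul ε⁻¹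
    have hz' : ε⁻¹ • ε • z = z := inv_smul_smul₀ hε z
    have hd := HasFDerivAt.comp (g := ρ) (ε • z)
      (hρ.differentiable one_ne_zero (ε⁻¹ • ε • z)).hasFDerivAt hK
    refine uniqueDiffWithinAt_of_pos_subset hd (by simpa [h2, hz'] using hzf) (fun h0 => ?_)
      (Eventually.of_forall fun w hw hw' => ?_)
    · refine h3 _ hzf ?_
      rw [hz'] at h0
      ext v
      have := congrArg (fun L : Euc n →L[ℝ] ℝ => L (ε • v)) h0
      simpa [hε] using this
    · refine pos_imp_notMem_closure h1 h2 hw (subset_closure ?_)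
      exact (mem_smul_set_iff_inv_smul_mem₀ hε _ _).1 hw'
  · refine UniqueDiffWithinAt.mono (s := ε • (closure ω)ᶜ) ?_ ?_
    · exact (isClosed_closure.isOpen_compl.smul₀ hε).uniqueDiffWithinAt (smul_mem_smul_set hzf)
    · rintro _ ⟨v, hv, rfl⟩ h
      exact hv (subset_closure ((smul_mem_smul_set_iff₀ hε _ _).1 h))

lemma volume_frontier_omegaZero (hρ : ContDiff ℝ 1 ρ) (hω : IsOpen ω) (hb : IsBounded ω)
    (h0 : (0 : Euc n) ∈ ω) (h2 : frontier ω = {x | ρ x = 0})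
    (h3 : ∀ x ∈ frontier ω, fderiv ℝ ρ x ≠ 0) : volume (frontier (omegaZero ω)) = 0 := by
  have hv : volume (frontier ω) = 0 :=
    volume_regular_zero_set hρ (fun x hx => by simpa [h2] using hx) h3
  refine measure_mono_null (t := invMap '' frontier ω) (fun z hz =>
    ⟨invMap z, (mem_frontier_omegaZero hω hb hz).2, invMap_invMap z⟩) ?_
  refine addHaar_image_eq_zero_of_differentiableOn_of_addHaar_eq_zero volume (fun x hx => ?_) hv
  have hx0 : x ≠ 0 := by
    rintro rfl
    rw [hω.frontier_eq] at hx
    exact hx.2 h0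
  rw [← kap_one]
  exact (hasFDerivAt_kap hx0 1).differentiableAt.differentiableWithinAt

end RegularBoundary

section KelvinBoundary

variable {n : ℕ}

lemma kelvin_eventually_eq_zero {ε a : ℝ} (hε : 0 < ε) (ha : a ≠ 0) {φ : Euc n → ℝ}
    (hφ : HasCompactSupport φ) : kelvin ε a φ =ᶠ[nhds 0] fun _ => 0 := by
  obtain ⟨R, hR0, hR⟩ := hφ.isCompact.isBounded.subset_closedBall_lt 0 0
  filter_upwards [ball_mem_nhds (0 : Euc n) (div_pos hε hR0)] with z hz
  rcases eq_or_ne z 0 with rfl | hz0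
  · simp [kelvin, Real.zero_rpow ha]
  have h0 : 0 < ‖z‖ := norm_pos_iff.2 hz0
  have : φ (kap ε z) = 0 := image_eq_zero_of_notMem_tsupport fun h => by
    have h1 := mem_closedBall_zero_iff.1 (hR h)
    rw [norm_kap hε, div_le_iff₀ h0] at h1
    rw [mem_ball_zero_iff, lt_div_iff₀ hR0] at hz
    linarith
  simp [kelvin, this]

/-- Vanishing derivatives of order `< j` are preserved by composition and multiplication with
smooth functions. -/
lemma iteratedFDerivWithin_mul_comp_eq_zero {s t : Set (Euc n)} {φ g : Euc n → ℝ}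
    {κ : Euc n → Euc n} {m j : ℕ} (hjm : j ≤ m) (hφ : ContDiffOn ℝ m φ t)
    (hg : ContDiffOn ℝ m g s) (hκ : ContDiffOn ℝ m κ s) (ht : UniqueDiffOn ℝ t)
    (hs : UniqueDiffOn ℝ s) (hst : MapsTo κ s t) {x : Euc n} (hx : x ∈ s)
    (h0 : ∀ i < j, iteratedFDerivWithin ℝ i φ t (κ x) = 0) {i : ℕ} (hi : i < j) :
    iteratedFDerivWithin ℝ i (fun y => g y * φ (κ y)) s x = 0 := by
  have hcomp : ∀ l < j, iteratedFDerivWithin ℝ l (φ ∘ κ) s x = 0 := fun l hl => by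
    rw [← norm_le_zero_iff]
    set B : ℝ := 1 + ∑ p ∈ Finset.range (l + 1), ‖iteratedFDerivWithin ℝ p κ s x‖
    have hB1 : 1 ≤ B := le_add_of_nonneg_right (Finset.sum_nonneg fun _ _ => norm_nonneg _)
    have := norm_iteratedFDerivWithin_comp_le (C := 0) (D := B) hφ hκ
      (n := l) (by exact_mod_cast hl.le.trans hjm) ht hs hst hx
      (fun p hp => by rw [h0 p (hp.trans_lt hl), norm_zero]) (fun p hp1 hp => by
        refine le_trans ?_ (le_self_pow₀ hB1 (by omega))
        have := Finset.single_le_sum (f := fun p => ‖iteratedFDerivWithin ℝ p κ s x‖)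
          (fun _ _ => norm_nonneg _) (Finset.mem_range.2 (Nat.lt_succ_of_le hp))
        simp only [B]
        linarith)
    simpa using this
  rw [← norm_le_zero_iff]
  refine (norm_iteratedFDerivWithin_mul_le hg (hφ.comp hκ hst) hs hx
    (n := i) (by exact_mod_cast hi.le.trans hjm)).trans_eq ?_
  refine Finset.sum_eq_zero fun p _ => ?_
  rw [hcomp (i - p) (by omega), norm_zero, mul_zero]

lemma bdryClass_kelvin {ω : Set (Euc n)} {ρ : Euc n → ℝ} (hρ : ContDiff ℝ 1 ρ) (hω : IsOpen ω)
    (hb : IsBounded ω) (hω0 : (0 : Euc n) ∈ ω)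
    (h1 : ω = {x | ρ x < 0}) (h2 : frontier ω = {x | ρ x = 0})
    (h3 : ∀ x ∈ frontier ω, fderiv ℝ ρ x ≠ 0) {ε a : ℝ} (hε : 0 < ε) (ha : a ≠ 0) {m j : ℕ}
    (hjm : j ≤ m) {φ : Euc n → ℝ} (hφ : ContDiffOn ℝ m φ (ε • ω)ᶜ) (hc : HasCompactSupport φ)
    (h0 : ∀ i < j, ∀ x ∈ frontier (ε • ω), iteratedFDerivWithin ℝ i φ (ε • ω)ᶜ x = 0) :
    BdryClass (omegaZero ω) m j (kelvin ε a φ) := by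
  set D := omegaZero ω
  have hD : IsOpen D := isOpen_omegaZero hb
  have hU : UniqueDiffOn ℝ (closure D) := uniqueDiffOn_closure_omegaZero hρ hω hb h1 h2 h3
  have hV : UniqueDiffOn ℝ (ε • ω)ᶜ := uniqueDiffOn_compl_smul hρ hω h1 h2 h3 hε.ne'
  set s := closure D ∩ {0}ᶜ
  have ho : IsOpen ({0}ᶜ : Set (Euc n)) := isOpen_compl_singleton
  have hs : UniqueDiffOn ℝ s := hU.inter ho
  have hst : MapsTo (kap ε) s (ε • ω)ᶜ := fun z hz h =>
    invMap_notMem_of_mem_closure_omegaZero hω hz.1 hz.2 ((kap_mem_smul_set hε.ne').1 h)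
  have hg : ContDiffOn ℝ m (fun y : Euc n => ‖y‖ ^ a) s := fun z hz =>
    (contDiffAt_norm_rpow_of_ne hz.2 a).contDiffWithinAt
  have hκ : ContDiffOn ℝ m (kap ε) s := fun z hz => (contDiffAt_kap hz.2 ε).contDiffWithinAt
  have hu : ContDiffOn ℝ m (kelvin ε a φ) s := hg.mul (hφ.comp hκ hst)
  refine ContDiffOn.bdryClass hD (isBounded_omegaZero hω hω0) hU (fun z hz => ?_)
    (fun i hi z hz => ?_)
  · rcases eq_or_ne z 0 with rfl | hz0
    · exact ((contDiffAt_const (c := (0 : ℝ))).congr_of_eventuallyEq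
        (kelvin_eventually_eq_zero hε ha hc)).contDiffWithinAt
    · exact (contDiffWithinAt_inter (ho.mem_nhds hz0)).1 (hu z ⟨hz, hz0⟩)
  · obtain ⟨hz0, hzf⟩ := mem_frontier_omegaZero hω hb hz
    rw [← iteratedFDerivWithin_inter_open ho hz0]
    exact iteratedFDerivWithin_mul_comp_eq_zero hjm hφ hg hκ hV hs hst
      ⟨frontier_subset_closure hz, hz0⟩
      (fun i hi => h0 i hi _ ((mem_frontier_smul_set hε.ne').2 hzf)) hi

lemma kap_eq_inversion {ε : ℝ} (hε : 0 < ε) (x : Euc n) :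
    kap ε x = EuclideanGeometry.inversion 0 (√ε) x := by
  simp only [kap, invMap, EuclideanGeometry.inversion, dist_zero_right, vsub_eq_sub, sub_zero,
    vadd_eq_add, add_zero, div_pow, Real.sq_sqrt hε.le, smul_smul]
  rfl

lemma abs_det_fderiv_kap {ε : ℝ} (hε : 0 < ε) {x : Euc n} (hx : x ≠ 0) :
    |(fderiv ℝ (kap ε) x).det| = (ε * (‖x‖ ^ 2)⁻¹) ^ n := by
  have h := EuclideanGeometry.hasFDerivAt_inversion (R := √ε) hx
  have e : kap ε = EuclideanGeometry.inversion (0 : Euc n) (√ε) :=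
    funext fun y => kap_eq_inversion hε y
  rw [e, h.fderiv, ContinuousLinearMap.det, ContinuousLinearMap.toLinearMap_smul,
    LinearMap.det_smul]
  have h1 := Submodule.det_reflection (Submodule.span ℝ {x - 0} : Submodule ℝ (Euc n))ᗮ
  have h2 : (((Submodule.span ℝ {x - 0} : Submodule ℝ (Euc n))ᗮ.reflection :
      Euc n →L[ℝ] Euc n) : Euc n →ₗ[ℝ] Euc n) =
      (Submodule.span ℝ {x - 0} : Submodule ℝ (Euc n))ᗮ.reflection.toLinearMap := rfl
  rw [h2, h1, abs_mul, abs_neg_one_pow, mul_one, abs_pow, abs_pow, sq_abs,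
    finrank_euclideanSpace_fin, dist_zero_right, div_pow, Real.sq_sqrt hε.le, div_eq_mul_inv]

lemma setIntegral_omegaZero {ω : Set (Euc n)} (hω0 : (0 : Euc n) ∈ ω) (hn : 0 < n)
    {ε : ℝ} (hε : 0 < ε) (F : Euc n → ℝ) :
    ∫ z in omegaZero ω, F z =
      ∫ y in (closure (ε • ω))ᶜ, (ε * (‖y‖ ^ 2)⁻¹) ^ n * F (kap ε y) := by
  have hne : ∀ y ∈ (closure (ε • ω))ᶜ, y ≠ 0 := fun y hy h =>
    hy (subset_closure ⟨0, hω0, by simp [h]⟩)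
  have himg : omegaZero ω = kap ε '' (closure (ε • ω))ᶜ ∪ {0} := by
    rw [closure_smul₀' hε.ne']
    ext z
    rw [mem_omegaZero_iff]
    constructor
    · rintro (h | h)
      · exact Or.inr h
      · exact Or.inl ⟨kap ε z, fun h' => h ((kap_mem_smul_set hε.ne').1 h'), kap_kap hε z⟩
    · rintro (⟨y, hy, rfl⟩ | h)
      · right
        intro h
        refine hy ?_
        rw [← kap_kap hε y]
        exact (kap_mem_smul_set hε.ne').2 h
      · exact Or.inl h
  have : Nonempty (Fin n) := ⟨⟨0, hn⟩⟩
  have hae : (omegaZero ω : Set (Euc n)) =ᵐ[volume] kap ε '' (closure (ε • ω))ᶜ := by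
    rw [himg]
    exact union_ae_eq_left_of_ae_eq_empty (by simp [ae_eq_empty])
  rw [setIntegral_congr_set hae, integral_image_eq_integral_abs_det_fderiv_smul volume
    isClosed_closure.isOpen_compl.measurableSet
    (fun y hy => (hasFDerivAt_kap (hne y hy) ε).differentiableAt.hasFDerivAt.hasFDerivWithinAt)
    (fun x _ y _ h => by rw [← kap_kap hε x, h, kap_kap hε y])]
  refine setIntegral_congr_fun isClosed_closure.isOpen_compl.measurableSet fun y hy => ?_
  simp only [smul_eq_mul, abs_det_fderiv_kap hε (hne y hy)]

end KelvinBoundary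

/-- Green representation formula in the exterior domain `ℝⁿ ∖ εω`. -/
theorem exterior_green_representation
    (n k : ℕ) (θ : ℝ) (hk : 1 ≤ k) (hn : 2*k < n) (hθ : θ ∈ Ioo (0:ℝ) 1)
    (ω : Set (Euc n)) (hω : IsHolderDomain n (2*k) θ ω) (h0ω : (0 : Euc n) ∈ ω)
    (ε : ℝ) (hε : 0 < ε)
    (G₀ : Euc n → Euc n → ℝ) (hG₀ : IsGreenFunction k θ (omegaZero ω) G₀)
    (φ : Euc n → ℝ)
    (hφsm : ContDiffOn ℝ (2*k) φ (ε • ω)ᶜ)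
    (hφsupp : HasCompactSupport φ)
    (hφbc : ∀ i : ℕ, i < k → ∀ x ∈ frontier (ε • ω),
      iteratedFDerivWithin ℝ i φ (ε • ω)ᶜ x = 0) :
    ∀ x ∉ closure (ε • ω),
      φ x = ∫ y in (closure (ε • ω))ᶜ, extGreen k G₀ ε x y * polyLap k φ y := by
  intro x hx
  obtain ⟨hωo, hb, -, ρ, hρ, -, h1, h2, h3⟩ := hω
  have hρ1 : ContDiff ℝ 1 ρ := hρ.of_le (by exact_mod_cast (by omega : 1 ≤ 2 * k))
  set a : ℝ := 2 * (k : ℝ) - n with ha_def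
  have hnk : 2 * (k : ℝ) < n := by exact_mod_cast hn
  have ha : a ≠ 0 := by simp only [ha_def]; linarith
  have hφ : ContDiffOn ℝ (2 * k : ℕ) φ (ε • ω)ᶜ := by exact_mod_cast hφsm
  have hB : BdryClass (omegaZero ω) (2 * k) k (kelvin ε a φ) :=
    bdryClass_kelvin hρ1 hωo hb h0ω h1 h2 h3 hε ha (by omega) hφ hφsupp hφbc
  have hne : ∀ y ∉ closure (ε • ω), y ≠ 0 := fun y hy h =>
    hy (subset_closure ⟨0, h0ω, by simp [h]⟩)
  have hx0 := norm_pos_iff.2 (hne x hx)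
  have hzD : kap ε x ∈ omegaZero ω := mem_omegaZero_iff.2 <| Or.inr fun h => hx <| by
    rw [closure_smul₀' hε.ne', ← kap_kap hε x]
    exact (kap_mem_smul_set hε.ne').2 h
  have hrep := hG₀.representation (isOpen_omegaZero hb) (isBounded_omegaZero hωo h0ω)
    (volume_frontier_omegaZero hρ1 hωo hb h0ω h2 h3)
    (uniqueDiffOn_closure_omegaZero hρ1 hωo hb h1 h2 h3) hθ hB hzD
  rw [setIntegral_omegaZero h0ω (by omega) hε] at hrep
  have hV : IsOpen (closure (ε • ω))ᶜ := isClosed_closure.isOpen_compl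
  have hL : ∀ y ∈ (closure (ε • ω))ᶜ,
      (ε * (‖y‖ ^ 2)⁻¹) ^ n * (G₀ (kap ε x) (kap ε y) * polyLap k (kelvin ε a φ) (kap ε y)) =
        ‖y‖ ^ a * G₀ (kap ε x) (kap ε y) * polyLap k φ y := fun y hy => by
    have hy0 := norm_pos_iff.2 (hne y hy)
    have h := polyLap_kelvin hV ε (hφ.mono (compl_subset_compl.2 subset_closure))
      (kap_ne_zero hε (hne y hy)) (by rwa [kap_kap hε])
    rw [← ha_def] at h
    rw [h]
    simp only [kelvin, kap_kap hε, norm_kap hε]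
    have hc : (ε * (‖y‖ ^ 2)⁻¹) ^ n * (ε ^ (2 * k) * (ε / ‖y‖) ^ (-2 * (k : ℝ) - n)) =
        ‖y‖ ^ a := by
      rw [Real.div_rpow hε.le hy0.le, mul_pow, ← Real.rpow_natCast ε n,
        ← Real.rpow_natCast ε (2 * k), inv_pow, ← pow_mul, ← Real.rpow_natCast ‖y‖ (2 * n),
        ← Real.rpow_neg hy0.le, div_eq_mul_inv, ← Real.rpow_neg hy0.le]
      have e1 : ε ^ ((n : ℕ) : ℝ) * ε ^ ((2 * k : ℕ) : ℝ) * ε ^ (-2 * (k : ℝ) - n) = 1 := by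
        rw [← Real.rpow_add hε, ← Real.rpow_add hε]
        convert Real.rpow_zero ε using 2
        push_cast
        ring
      have e2 : ‖y‖ ^ (-((2 * n : ℕ) : ℝ)) * ‖y‖ ^ (-(-2 * (k : ℝ) - n)) = ‖y‖ ^ a := by
        rw [← Real.rpow_add hy0]
        congr 1
        push_cast
        ring
      rw [← e2]
      linear_combination ‖y‖ ^ (-((2 * n : ℕ) : ℝ)) * ‖y‖ ^ (-(-2 * (k : ℝ) - n)) * e1
    rw [← hc]
    ring
  rw [setIntegral_congr_fun hV.measurableSet hL] at hrep
  have hx1 : kelvin ε a φ (kap ε x) = ε ^ a * ‖x‖ ^ (-a) * φ x := by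
    simp only [kelvin, kap_kap hε, norm_kap hε]
    rw [Real.div_rpow hε.le hx0.le, div_eq_mul_inv, ← Real.rpow_neg hx0.le]
  have hx2 : φ x = ε ^ (-a) * ‖x‖ ^ a * kelvin ε a φ (kap ε x) := by
    have e1 : ε ^ (-a) * ε ^ a = 1 := by rw [← Real.rpow_add hε]; simp
    have e2 : ‖x‖ ^ a * ‖x‖ ^ (-a) = 1 := by rw [← Real.rpow_add hx0]; simp
    rw [hx1]
    linear_combination -φ x * e1 - ε ^ (-a) * ε ^ a * φ x * e2
  rw [hx2, hrep, ← integral_const_mul]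
  refine integral_congr_ae (Eventually.of_forall fun y => ?_)
  simp only [extGreen, kap, ← ha_def, show (n : ℝ) - 2 * k = -a by simp [ha_def]]
  ring
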